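/- There exists a bounded linear operator T on the complex Hilbert space ℓ²(ℕ, ℂ) that is polynomially bounded (there is C > 0 with ‖p(T)‖ ≤ C · sup_{|z| ≤ 1} |p(z)| for every complex polynomial p) but not completely polynomially bounded: for every constant c > 0 there exist m ≥ 1 and m×m complex matrices D₀, …, D_d with sup_{|z| ≤ 1} ‖∑_{j=0}^d z^j D_j‖ ≤ 1, such that the block operator on the m-fold Hilbert direct sum (ℓ²(ℕ, ℂ))^m whose (r, s) block entry is ∑_{j=0}^d (D_j)_{r s} T^j has operator norm greater than c. -/

import Mathlib

open Matrix

section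

open Polynomial Finset MeasureTheory

theorem Polynomial.coeff_mul_eq_of_coeff_eq {R : Type*} [Semiring R] (q : R[X]) {a b : R[X]} {n : ℕ}
    (h : ∀ l < n, a.coeff l = b.coeff l) {i : ℕ} (hi : i < n) :
    (q * a).coeff i = (q * b).coeff i := by
  rw [coeff_mul, coeff_mul]
  refine sum_congr rfl fun x hx => ?_
  rw [h]
  have := mem_antidiagonal.1 hx
  omega

theorem Polynomial.circleAverage_sq_norm_eval_mul_le {f : ℂ[X]} {M : ℝ}
    (hf : ∀ z : ℂ, ‖z‖ ≤ 1 → ‖f.eval z‖ ≤ M) (a : ℂ[X]) :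
    ∑ i ∈ (f * a).support, ‖(f * a).coeff i‖ ^ 2 ≤ M ^ 2 * ∑ i ∈ a.support, ‖a.coeff i‖ ^ 2 := by
  rw [sum_sq_norm_coeff_eq_circleAverage, sum_sq_norm_coeff_eq_circleAverage]
  have e : M ^ 2 * Real.circleAverage (fun θ ↦ ‖a.eval θ‖ ^ 2) 0 1
      = Real.circleAverage (fun θ ↦ M ^ 2 * ‖a.eval θ‖ ^ 2) 0 1 := by
    have := Real.circleAverage_fun_smul (a := M ^ 2) (f := fun θ : ℂ ↦ ‖a.eval θ‖ ^ 2) (c := 0) (R := 1)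
    simpa using this.symm
  rw [e]
  refine Real.circleAverage_mono ?_ ?_ ?_
  · exact (Continuous.continuousOn (by fun_prop)).circleIntegrable'
  · exact (Continuous.continuousOn (by fun_prop)).circleIntegrable'
  · intro z hz
    have hz' : ‖z‖ ≤ 1 := by simp at hz; exact hz.le
    simp only [eval_mul, norm_mul, mul_pow]
    have := hf z hz'
    gcongr

theorem Polynomial.sum_sq_norm_coeff_eq_sum_range (a : ℂ[X]) {n : ℕ} (h : ∀ l, n ≤ l → a.coeff l = 0) :
    ∑ i ∈ a.support, ‖a.coeff i‖ ^ 2 = ∑ i ∈ range n, ‖a.coeff i‖ ^ 2 := by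
  refine sum_subset (fun i hi => ?_) (fun i _ hi => ?_)
  · by_contra hc
    exact (mem_support_iff.1 hi) (h i (by simpa using hc))
  · simp [notMem_support_iff.1 hi]

theorem Polynomial.sum_sq_norm_coeff_mul_le {f : ℂ[X]} {M : ℝ}
    (hf : ∀ z : ℂ, ‖z‖ ≤ 1 → ‖f.eval z‖ ≤ M) (a : ℂ[X]) (n : ℕ) :
    ∑ l ∈ range n, ‖(f * a).coeff l‖ ^ 2 ≤ M ^ 2 * ∑ l ∈ range n, ‖a.coeff l‖ ^ 2 := by
  set b : ℂ[X] := ∑ l ∈ range n, monomial l (a.coeff l) with hb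
  have hbc : ∀ l, b.coeff l = if l < n then a.coeff l else 0 := by
    intro l
    simp [hb, coeff_monomial]
  have h1 : ∑ l ∈ range n, ‖(f * a).coeff l‖ ^ 2 = ∑ l ∈ range n, ‖(f * b).coeff l‖ ^ 2 := by
    refine sum_congr rfl fun l hl => ?_
    rw [coeff_mul_eq_of_coeff_eq f (b := b) (n := n) _ (mem_range.1 hl)]
    intro l hl
    simp [hbc, hl]
  have h2 : ∑ l ∈ range n, ‖a.coeff l‖ ^ 2 = ∑ l ∈ range n, ‖b.coeff l‖ ^ 2 := by
    refine sum_congr rfl fun l hl => ?_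
    simp [hbc, mem_range.1 hl]
  rw [h1, h2, ← sum_sq_norm_coeff_eq_sum_range b (n := n) (fun l hl => by simp [hbc, hl])]
  refine le_trans ?_ (circleAverage_sq_norm_eval_mul_le hf b)
  have h3 : ∑ i ∈ (f * b).support, ‖(f * b).coeff i‖ ^ 2
      = ∑ i ∈ range (max n ((f * b).natDegree + 1)), ‖(f * b).coeff i‖ ^ 2 :=
    sum_sq_norm_coeff_eq_sum_range _ fun l hl =>
      coeff_eq_zero_of_natDegree_lt (by have := le_max_right n ((f * b).natDegree + 1); omega)
  rw [h3]
  exact sum_le_sum_of_subset_of_nonneg (range_mono (le_max_left _ _)) fun _ _ _ => by positivity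

theorem Finset.sum_range_mul_le_of_antitone {w x y : ℕ → ℝ} (hw : Antitone w) (hw0 : ∀ n, 0 ≤ w n)
    (h : ∀ n, ∑ l ∈ range n, x l ≤ ∑ l ∈ range n, y l) (n : ℕ) :
    ∑ l ∈ range n, w l * x l ≤ ∑ l ∈ range n, w l * y l := by
  have key : ∀ n, w n * (∑ l ∈ range n, y l - ∑ l ∈ range n, x l)
      ≤ ∑ l ∈ range n, w l * y l - ∑ l ∈ range n, w l * x l := by
    intro n
    induction n with
    | zero => simp
    | succ n ih =>
      have h1 := h (n + 1)
      have h2 := hw (Nat.le_succ n)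
      simp only [sum_range_succ] at *
      nlinarith [mul_le_mul_of_nonneg_right h2 (sub_nonneg.2 h1)]
  have := mul_nonneg (hw0 n) (sub_nonneg.2 (h n))
  linarith [key n]

theorem sum_range_div_cube_mul_le {b : ℕ → ℝ} (hb : ∀ l, 0 ≤ b l) (N : ℕ) :
    ∑ k ∈ range N, (1 / ((k : ℝ) + 1) ^ 3) * ∑ l ∈ range k, ((l : ℝ) + 1) ^ 2 * b l
      ≤ 1 / 2 * ∑ l ∈ range N, b l := by
  suffices h : ∑ k ∈ range N, (1 / ((k : ℝ) + 1) ^ 3) * ∑ l ∈ range k, ((l : ℝ) + 1) ^ 2 * b l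
      + 1 / (2 * (N : ℝ) ^ 2) * ∑ l ∈ range N, ((l : ℝ) + 1) ^ 2 * b l
      ≤ 1 / 2 * ∑ l ∈ range N, b l by
    have : 0 ≤ 1 / (2 * (N : ℝ) ^ 2) * ∑ l ∈ range N, ((l : ℝ) + 1) ^ 2 * b l :=
      mul_nonneg (by positivity) (sum_nonneg fun l _ => mul_nonneg (by positivity) (hb l))
    linarith
  induction N with
  | zero => simp
  | succ N ih =>
    simp only [sum_range_succ] at *
    set A := ∑ l ∈ range N, ((l : ℝ) + 1) ^ 2 * b l with hA
    have hA0 : 0 ≤ A := sum_nonneg fun l _ => mul_nonneg (by positivity) (hb l)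
    have h1 : 1 / (2 * ((N + 1 : ℕ) : ℝ) ^ 2) * (A + ((N : ℝ) + 1) ^ 2 * b N)
        = 1 / (2 * ((N : ℝ) + 1) ^ 2) * A + b N / 2 := by
      push_cast
      field_simp
    rw [h1]
    have h2 : (1 / ((N : ℝ) + 1) ^ 3 + 1 / (2 * ((N : ℝ) + 1) ^ 2)) * A ≤ 1 / (2 * (N : ℝ) ^ 2) * A := by
      rcases Nat.eq_zero_or_pos N with rfl | hN
      · simp [hA]
      · refine mul_le_mul_of_nonneg_right ?_ hA0
        have hN' : (1 : ℝ) ≤ N := by exact_mod_cast hN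
        rw [div_add_div _ _ (by positivity) (by positivity), div_le_div_iff₀ (by positivity) (by positivity)]
        have : 0 ≤ ((N : ℝ) + 1) ^ 2 * (3 * N + 1) := by positivity
        nlinarith
    linarith

theorem sum_range_kernel_le (j N : ℕ) :
    ∑ k ∈ range N, (if j ≤ k then 3 * (j : ℝ) / ((k : ℝ) + 1) ^ 2 else 2 / (j : ℝ)) ≤ 5 := by
  suffices h : ∑ k ∈ range N, (if j ≤ k then 3 * (j : ℝ) / ((k : ℝ) + 1) ^ 2 else 2 / (j : ℝ))
      ≤ if N ≤ j then 2 * (N : ℝ) / j else 5 - 3 * j / N by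
    refine h.trans ?_
    split_ifs with hN
    · rcases Nat.eq_zero_or_pos j with rfl | hj
      · simp
      · have hj' : (0 : ℝ) < j := by exact_mod_cast hj
        have : (N : ℝ) ≤ j := by exact_mod_cast hN
        rw [div_le_iff₀ hj']; linarith
    · have : 0 ≤ 3 * (j : ℝ) / N := by positivity
      linarith
  induction N with
  | zero => simp
  | succ N ih =>
    rw [sum_range_succ]
    rcases lt_trichotomy N j with h | h | h
    · have hj : (0 : ℝ) < j := by exact_mod_cast (by omega : 0 < j)
      simp only [h.le, if_true, not_le.2 h, if_false, Nat.succ_le_of_lt h] at ih ⊢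
      push_cast
      calc _ ≤ _ := add_le_add_left ih _
        _ = _ := by field_simp
    · subst h
      simp only [le_refl, if_true, if_neg (Nat.not_succ_le_self N)] at ih ⊢
      have : 2 * (N : ℝ) / N ≤ 2 := by
        rcases Nat.eq_zero_or_pos N with rfl | hj
        · simp
        · have hj' : (0 : ℝ) < N := by exact_mod_cast hj
          rw [div_le_iff₀ hj']
      have h3 : 3 * (N : ℝ) / (N + 1) ^ 2 ≤ 3 - 3 * N / (N + 1) := by
        rw [div_le_iff₀ (by positivity)]
        field_simp
        nlinarith
      push_cast
      linarith
    · simp only [h.le, if_true, not_le.2 h, if_false, not_le.2 (Nat.lt_succ_of_lt h)] at ih ⊢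
      have hN : (0 : ℝ) < N := by exact_mod_cast (by omega : 0 < N)
      have h3 : 3 * (j : ℝ) / (N + 1) ^ 2 ≤ 3 * j / N - 3 * j / (N + 1) := by
        rw [div_sub_div _ _ (by positivity) (by positivity), div_le_div_iff₀ (by positivity) (by positivity)]
        have : 0 ≤ (j : ℝ) * (N + 1) := by positivity
        nlinarith
      push_cast
      linarith

open MeasureTheory in
theorem exists_measure_integral_pow_mul_conj_pow :
    ∃ μ : Measure ℂ, (∀ g : ℂ → ℂ, Continuous g → Integrable g μ) ∧
      ∀ a b : ℕ, ∫ z, z ^ a * (starRingEnd ℂ z) ^ b ∂μ =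
        if a = b then (1 / (((a : ℂ) + 1) * ((a : ℂ) + 2)) : ℂ) else 0 := by
  let w : ℝ → NNReal := fun r => Real.toNNReal (2 * r * (1 - r ^ 2))
  have hw : Measurable w := by fun_prop
  let ρ : Measure ℝ := (volume.restrict (Set.Ioc 0 1)).withDensity fun r => (w r : ENNReal)
  let θ : Measure ℝ := (volume.restrict (Set.Ioc 0 1))
  let φ : ℝ × ℝ → ℂ := fun p => p.1 * Complex.exp (2 * Real.pi * Complex.I * p.2)
  have hφ : Continuous φ := by fun_prop
  have hρ : IsFiniteMeasure ρ := by
    refine isFiniteMeasure_withDensity (ne_of_lt ?_)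
    calc ∫⁻ r in Set.Ioc (0 : ℝ) 1, (w r : ENNReal) ≤ ∫⁻ r in Set.Ioc (0 : ℝ) 1, 2 := by
          refine setLIntegral_mono measurable_const fun r hr => ?_
          have : w r ≤ 2 := by
            rw [Real.toNNReal_le_iff_le_coe]
            push_cast
            nlinarith [hr.1, hr.2, mul_nonneg hr.1.le (sq_nonneg r)]
          exact_mod_cast this
      _ < ⊤ := by simp
  have hρ1 : ∀ᵐ r ∂ρ, r ∈ Set.Ioc (0 : ℝ) 1 :=
    (withDensity_absolutelyContinuous _ _).ae_le (ae_restrict_mem measurableSet_Ioc)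
  refine ⟨(ρ.prod θ).map φ, fun g hg => ?_, fun a b => ?_⟩
  · have hfin : IsFiniteMeasure ((ρ.prod θ).map φ) := by infer_instance
    obtain ⟨C, hC⟩ := (isCompact_closedBall (0 : ℂ) 1).exists_bound_of_continuousOn hg.continuousOn
    refine Integrable.of_bound hg.aestronglyMeasurable C ?_
    have : ∀ᵐ z ∂((ρ.prod θ).map φ), z ∈ Metric.closedBall (0 : ℂ) 1 := by
      refine (ae_map_iff hφ.aemeasurable (p := fun z => z ∈ Metric.closedBall (0 : ℂ) 1)
        Metric.isClosed_closedBall.measurableSet).2 ?_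
      have := (Measure.quasiMeasurePreserving_fst (μ := ρ) (ν := θ)).ae hρ1
      filter_upwards [this] with p hp
      have : Complex.exp (2 * Real.pi * Complex.I * p.2) =
        Complex.exp ((2 * Real.pi * p.2 : ℝ) * Complex.I) := by push_cast; ring_nf
      simp only [φ, mem_closedBall_zero_iff, norm_mul, this, Complex.norm_exp_ofReal_mul_I,
        Complex.norm_real, mul_one, Real.norm_eq_abs, abs_of_pos hp.1]
      exact hp.2
    filter_upwards [this] with z hz using hC z hz
  · rw [integral_map hφ.aemeasurable
      (Continuous.aestronglyMeasurable (by fun_prop))]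
    have e : ∀ p : ℝ × ℝ, φ p ^ a * (starRingEnd ℂ (φ p)) ^ b
        = (p.1 : ℂ) ^ (a + b) *
          Complex.exp (2 * Real.pi * Complex.I * ((a : ℤ) - (b : ℤ) : ℤ) * p.2) := by
      intro p
      have : starRingEnd ℂ (Complex.exp (2 * Real.pi * Complex.I * p.2))
          = Complex.exp (-(2 * Real.pi * Complex.I * p.2)) := by
        rw [← Complex.exp_conj]; congr 1; simp [Or.inl (map_ofNat (starRingEnd ℂ) 2)]
      simp only [φ, map_mul, Complex.conj_ofReal, this, mul_pow, ← Complex.exp_nat_mul, pow_add]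
      rw [mul_mul_mul_comm, ← Complex.exp_add]
      congr 2
      push_cast; ring
    simp_rw [e]
    rw [integral_prod_mul (μ := ρ) (ν := θ) (fun r : ℝ => (r : ℂ) ^ (a + b))
      (fun t : ℝ => Complex.exp (2 * Real.pi * Complex.I * ((a : ℤ) - (b : ℤ) : ℤ) * t))]
    have hθ : ∫ t, Complex.exp (2 * Real.pi * Complex.I * ((a : ℤ) - (b : ℤ) : ℤ) * t) ∂θ
        = if a = b then 1 else 0 := by
      split_ifs with h
      · subst h; simp [θ]
      · change ∫ t in Set.Ioc (0 : ℝ) 1, _ = _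
        have hab : (((a : ℤ) - (b : ℤ) : ℤ) : ℂ) ≠ 0 := by
          rw [Int.cast_ne_zero, sub_ne_zero]; exact_mod_cast h
        rw [← intervalIntegral.integral_of_le zero_le_one, integral_exp_mul_complex]
        · have := Complex.exp_int_mul_two_pi_mul_I ((a : ℤ) - (b : ℤ))
          rw [mul_comm] at this
          simp only [Complex.ofReal_one, mul_one, Complex.ofReal_zero, mul_zero, Complex.exp_zero]
          rw [this]; simp
        · simpa [Real.pi_ne_zero] using hab
    rw [hθ]
    split_ifs with h
    · subst h
      rw [mul_one]
      change ∫ r, (r : ℂ) ^ (a + a) ∂((volume.restrict (Set.Ioc 0 1)).withDensity fun r => (w r : ENNReal)) = _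
      rw [integral_withDensity_eq_integral_smul hw]
      have : ∀ r ∈ Set.Ioc (0 : ℝ) 1, w r • (r : ℂ) ^ (a + a)
          = ((2 * r ^ (2 * a + 1) - 2 * r ^ (2 * a + 3) : ℝ) : ℂ) := by
        intro r hr
        have h0 : 0 ≤ 2 * r * (1 - r ^ 2) := by
          have := hr.1; have := hr.2
          have : r ^ 2 ≤ 1 := by nlinarith
          have : 0 ≤ 1 - r ^ 2 := by linarith
          positivity
        rw [NNReal.smul_def, Real.coe_toNNReal _ h0, Complex.real_smul]
        push_cast; ring
      rw [setIntegral_congr_fun measurableSet_Ioc this, integral_complex_ofReal,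
        ← intervalIntegral.integral_of_le zero_le_one, intervalIntegral.integral_sub
        (Continuous.intervalIntegrable (by fun_prop) _ _)
        (Continuous.intervalIntegrable (by fun_prop) _ _),
        intervalIntegral.integral_const_mul, intervalIntegral.integral_const_mul, integral_pow, integral_pow]
      push_cast
      have h1 : (a : ℂ) + 1 ≠ 0 := by exact_mod_cast Nat.succ_ne_zero a
      have h2 : (a : ℂ) + 2 ≠ 0 := by exact_mod_cast Nat.succ_ne_zero (a + 1)
      have h3 : 2 * (a : ℂ) + 1 + 1 ≠ 0 := by exact_mod_cast Nat.succ_ne_zero (2 * a + 1)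
      have h4 : 2 * (a : ℂ) + 3 + 1 ≠ 0 := by exact_mod_cast Nat.succ_ne_zero (2 * a + 3)
      simp only [one_pow, ne_eq, Nat.add_eq_zero_iff, one_ne_zero, and_false, not_false_eq_true, zero_pow]
      field_simp
      ring
    · simp

open MeasureTheory in
theorem integral_sq_norm_sum_of_orthogonal {α ι : Type*} [MeasurableSpace α] {μ : Measure α}
    (s : Finset ι) (h : ι → α → ℂ)
    (hint : ∀ i ∈ s, ∀ j ∈ s, Integrable (fun z => h i z * starRingEnd ℂ (h j z)) μ)
    (horth : ∀ i ∈ s, ∀ j ∈ s, i ≠ j → ∫ z, h i z * starRingEnd ℂ (h j z) ∂μ = 0) (v : ι → ℂ) :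
    ∫ z, ‖∑ i ∈ s, v i * h i z‖ ^ 2 ∂μ = ∑ i ∈ s, ‖v i‖ ^ 2 * ∫ z, ‖h i z‖ ^ 2 ∂μ := by
  have key : ∀ w : ℂ, ((‖w‖ ^ 2 : ℝ) : ℂ) = w * starRingEnd ℂ w := fun w => by
    rw [Complex.mul_conj']; push_cast; rfl
  apply Complex.ofReal_injective
  rw [← integral_complex_ofReal]
  push_cast only [Complex.ofReal_sum, Complex.ofReal_mul]
  simp_rw [← integral_complex_ofReal, key, map_sum, sum_mul_sum, map_mul]
  have e : ∀ z i j, v i * h i z * (starRingEnd ℂ (v j) * starRingEnd ℂ (h j z))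
      = v i * starRingEnd ℂ (v j) * (h i z * starRingEnd ℂ (h j z)) := fun z i j => by ring
  simp_rw [e]
  rw [integral_finsetSum]
  · refine sum_congr rfl fun i hi => ?_
    rw [integral_finsetSum _ fun j hj => (hint i hi j hj).const_mul _]
    rw [sum_eq_single_of_mem i hi]
    · rw [integral_const_mul]
    · intro j hj hji
      rw [integral_const_mul, horth i hi j hj hji.symm, mul_zero]
  · exact fun i hi => integrable_finsetSum _ fun j hj => (hint i hi j hj).const_mul _

theorem kernel_energy_le_of_le {j k : ℕ} (h : j ≤ k) :
    ((k : ℝ) + 2) ^ 2 / (((k + j : ℕ) + 1) * ((k + j : ℕ) + 2))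
      - 2 * ((k + 2) * ((k - j : ℕ) + 2)) / ((k + 1) * (k + 2))
      + ((k - j : ℕ) + 2 : ℝ) ^ 2 / (((k - j : ℕ) + 1) * ((k - j : ℕ) + 2)) ≤ 3 * j / (k + 1) := by
  obtain ⟨d, rfl⟩ := Nat.exists_eq_add_of_le h
  simp only [Nat.add_sub_cancel_left]
  push_cast
  have hd : (0 : ℝ) ≤ d := by positivity
  have hj : (0 : ℝ) ≤ j := by positivity
  generalize (d : ℝ) = d at *
  generalize (j : ℝ) = j at *
  have e1 : (j + d + 2) ^ 2 / ((j + d + j + 1) * (j + d + j + 2)) ≤ (j + d + 2) / (j + d + j + 1) := by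
    rw [div_le_div_iff₀ (by positivity) (by positivity)]
    have : 0 ≤ (j + d + 2) * (j + d + j + 1) * j := by positivity
    nlinarith
  have e2 : 2 * ((j + d + 2) * (d + 2)) / ((j + d + 1) * (j + d + 2)) = 2 * (d + 2) / (j + d + 1) := by
    field_simp
  have e3 : (d + 2) ^ 2 / ((d + 1) * (d + 2)) = (d + 2) / (d + 1) := by field_simp
  rw [e2, e3]
  have e4 : 3 * j / (j + d + 1) - ((j + d + 2) / (j + d + j + 1) - 2 * (d + 2) / (j + d + 1) + (d + 2) / (d + 1))
      = (j * d / (d + 1) + j * (j + d + 2) / (j + d + j + 1)) / (j + d + 1) := by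
    field_simp; ring
  have : 0 ≤ (j * d / (d + 1) + j * (j + d + 2) / (j + d + j + 1)) / (j + d + 1) := by positivity
  linarith

theorem kernel_energy_le_of_lt {j k : ℕ} (h : k < j) :
    ((k : ℝ) + 2) ^ 2 / (((k + j : ℕ) + 1) * ((k + j : ℕ) + 2)) ≤ 2 * (k + 1) / j := by
  obtain ⟨d, rfl⟩ := Nat.exists_eq_add_of_lt h
  push_cast
  have hd : (0 : ℝ) ≤ d := by positivity
  have hk : (0 : ℝ) ≤ k := by positivity
  generalize (d : ℝ) = d at *
  generalize (k : ℝ) = k at *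
  rw [div_le_div_iff₀ (by positivity) (by positivity)]
  have : 0 ≤ d ^ 2 * k ∧ 0 ≤ d * k ^ 2 ∧ 0 ≤ k ^ 3 ∧ 0 ≤ d ^ 2 ∧ 0 ≤ d * k ∧ 0 ≤ k ^ 2 := by
    refine ⟨?_, ?_, ?_, ?_, ?_, ?_⟩ <;> positivity
  obtain ⟨h1, h2, h3, h4, h5, h6⟩ := this
  nlinarith

/-- The moments of the measure `(1 - |z|²) dA(z) / π` on the unit disc, up to normalization,
together with integrability of continuous functions. -/
def HasWeightedBergmanMoments (μ : Measure ℂ) : Prop :=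
  (∀ g : ℂ → ℂ, Continuous g → Integrable g μ) ∧
    ∀ a b : ℕ, ∫ z, z ^ a * (starRingEnd ℂ z) ^ b ∂μ =
      if a = b then (1 / (((a : ℂ) + 1) * ((a : ℂ) + 2)) : ℂ) else 0

namespace HasWeightedBergmanMoments

theorem integrable_real {μ : Measure ℂ} (hμ : HasWeightedBergmanMoments μ)
    {g : ℂ → ℝ} (hg : Continuous g) : Integrable g μ := by
  have := (hμ.1 (fun z => (g z : ℂ)) (by fun_prop)).re
  simpa using this

theorem integral_norm_pow {μ : Measure ℂ} (hμ : HasWeightedBergmanMoments μ)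
    (a : ℕ) :
    ∫ z, ‖z‖ ^ (2 * a) ∂μ = 1 / (((a : ℝ) + 1) * (a + 2)) := by
  apply Complex.ofReal_injective
  rw [← integral_complex_ofReal]
  have := hμ.2 a a
  rw [if_pos rfl] at this
  push_cast
  rw [← this]
  congr 1; ext z
  rw [← mul_pow, Complex.mul_conj', pow_mul]

theorem integral_sq_norm_sum_conj_pow {μ : Measure ℂ} (hμ : HasWeightedBergmanMoments μ)
    (n : ℕ) (c : ℕ → ℂ) :
    ∫ z, ‖∑ l ∈ range n, c l * (starRingEnd ℂ z) ^ l‖ ^ 2 ∂μ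
      = ∑ l ∈ range n, ‖c l‖ ^ 2 * (1 / (((l : ℝ) + 1) * (l + 2))) := by
  rw [integral_sq_norm_sum_of_orthogonal (range n) (fun l z => (starRingEnd ℂ z) ^ l)]
  · refine sum_congr rfl fun l _ => ?_
    rw [← hμ.integral_norm_pow l]
    simp [pow_mul']
  · exact fun i _ j _ => hμ.1 _ (by fun_prop)
  · intro i _ j _ hij
    simp only [map_pow, Complex.conj_conj]
    simp_rw [mul_comm ((starRingEnd ℂ _) ^ i)]
    rw [hμ.2, if_neg (Ne.symm hij)]

theorem integral_sq_norm_sum_pow {μ : Measure ℂ} (hμ : HasWeightedBergmanMoments μ)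
    (n : ℕ) (c : ℕ → ℂ) :
    ∫ z, ‖∑ l ∈ range n, c l * z ^ l‖ ^ 2 ∂μ
      = ∑ l ∈ range n, ‖c l‖ ^ 2 * (1 / (((l : ℝ) + 1) * (l + 2))) := by
  have := hμ.integral_sq_norm_sum_conj_pow n (fun l => starRingEnd ℂ (c l))
  simp only [← map_pow, ← map_mul, ← map_sum, RCLike.norm_conj] at this
  exact this

/-- The integral of the kernel appearing in the commutator of a difference quotient. -/
theorem integral_sq_norm_kernel_le {μ : Measure ℂ} (hμ : HasWeightedBergmanMoments μ)
    (j k : ℕ) :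
    ∫ z, ‖((k : ℂ) + 2) * (starRingEnd ℂ z ^ k * z ^ j) -
        (if j ≤ k then ((k - j : ℕ) + 2 : ℂ) * starRingEnd ℂ z ^ (k - j) else 0)‖ ^ 2 ∂μ
      ≤ if j ≤ k then 3 * (j : ℝ) / (k + 1) else 2 * (k + 1) / j := by
  split_ifs with h
  · refine le_of_eq_of_le ?_ (kernel_energy_le_of_le h)
    have e : ∀ z : ℂ, ‖((k : ℂ) + 2) * (starRingEnd ℂ z ^ k * z ^ j) -
        ((k - j : ℕ) + 2 : ℂ) * starRingEnd ℂ z ^ (k - j)‖ ^ 2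
        = ((k : ℝ) + 2) ^ 2 * ‖z‖ ^ (2 * (k + j)) - 2 * ((k + 2) * ((k - j : ℕ) + 2)) * ‖z‖ ^ (2 * k)
          + ((k - j : ℕ) + 2 : ℝ) ^ 2 * ‖z‖ ^ (2 * (k - j)) := by
      intro z
      apply Complex.ofReal_injective
      have key : ∀ w : ℂ, ((‖w‖ ^ 2 : ℝ) : ℂ) = w * starRingEnd ℂ w := fun w => by
        rw [Complex.mul_conj']; push_cast; rfl
      rw [key]
      obtain ⟨d, rfl⟩ := Nat.exists_eq_add_of_le h
      simp only [Nat.add_sub_cancel_left, pow_mul]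
      push_cast
      simp only [← Complex.mul_conj']
      simp only [map_sub, map_mul, map_pow, map_add, map_natCast, Complex.conj_conj, map_ofNat]
      ring
    simp_rw [e]
    rw [integral_add, integral_sub, integral_const_mul, integral_const_mul, integral_const_mul,
      hμ.integral_norm_pow, hμ.integral_norm_pow, hμ.integral_norm_pow]
    · ring
    all_goals exact hμ.integrable_real (by fun_prop)
  · refine le_of_eq_of_le ?_ (kernel_energy_le_of_lt (not_le.1 h))
    have e : ∀ z : ℂ, ‖((k : ℂ) + 2) * (starRingEnd ℂ z ^ k * z ^ j) - 0‖ ^ 2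
        = ((k : ℝ) + 2) ^ 2 * ‖z‖ ^ (2 * (k + j)) := by
      intro z
      have : ‖(k : ℂ) + 2‖ = k + 2 := by
        have := Complex.norm_natCast (k + 2); push_cast at this; exact this
      simp only [sub_zero, norm_mul, norm_pow, RCLike.norm_conj, this]
      ring
    simp_rw [e]
    rw [integral_const_mul, hμ.integral_norm_pow]
    ring

theorem integral_kernel_mul_conj_eq_zero {μ : Measure ℂ} (hμ : HasWeightedBergmanMoments μ)
    (k : ℕ) {i j : ℕ} (hij : i ≠ j) :
    ∫ z, (((k : ℂ) + 2) * (starRingEnd ℂ z ^ k * z ^ i) -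
        (if i ≤ k then ((k - i : ℕ) + 2 : ℂ) * starRingEnd ℂ z ^ (k - i) else 0)) *
      starRingEnd ℂ (((k : ℂ) + 2) * (starRingEnd ℂ z ^ k * z ^ j) -
        (if j ≤ k then ((k - j : ℕ) + 2 : ℂ) * starRingEnd ℂ z ^ (k - j) else 0)) ∂μ = 0 := by
  set B : ℕ → ℂ := fun i => if i ≤ k then ((k - i : ℕ) + 2 : ℂ) else 0 with hB
  have hB' : ∀ i, (starRingEnd ℂ) (B i) = B i := by
    intro i; simp only [hB]; split_ifs <;> simp [map_ofNat]
  have e : ∀ z : ℂ, (((k : ℂ) + 2) * (starRingEnd ℂ z ^ k * z ^ i) -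
        (if i ≤ k then ((k - i : ℕ) + 2 : ℂ) * starRingEnd ℂ z ^ (k - i) else 0)) *
      starRingEnd ℂ (((k : ℂ) + 2) * (starRingEnd ℂ z ^ k * z ^ j) -
        (if j ≤ k then ((k - j : ℕ) + 2 : ℂ) * starRingEnd ℂ z ^ (k - j) else 0))
      = (k + 2) ^ 2 * (z ^ (i + k) * starRingEnd ℂ z ^ (j + k))
        - (k + 2) * B j * (z ^ (i + (k - j)) * starRingEnd ℂ z ^ k)
        - ((k + 2) * B i * (z ^ k * starRingEnd ℂ z ^ (j + (k - i)))
        - B i * B j * (z ^ (k - j) * starRingEnd ℂ z ^ (k - i))) := by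
    intro z
    have : ∀ i, (if i ≤ k then ((k - i : ℕ) + 2 : ℂ) * starRingEnd ℂ z ^ (k - i) else 0)
        = B i * starRingEnd ℂ z ^ (k - i) := by
      intro i; simp only [hB, ite_mul, zero_mul]
    rw [this, this]
    simp only [map_sub, map_mul, map_pow, map_add, map_natCast, Complex.conj_conj, map_ofNat, hB']
    ring
  simp_rw [e]
  have z1 : ∫ z, (k + 2 : ℂ) * B j * (z ^ (i + (k - j)) * starRingEnd ℂ z ^ k) ∂μ = 0 := by
    rw [integral_const_mul, hμ.2]
    by_cases h : j ≤ k
    · rw [if_neg (by omega), mul_zero]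
    · simp [hB, h]
  have z2 : ∫ z, (k + 2 : ℂ) * B i * (z ^ k * starRingEnd ℂ z ^ (j + (k - i))) ∂μ = 0 := by
    rw [integral_const_mul, hμ.2]
    by_cases h : i ≤ k
    · rw [if_neg (by omega), mul_zero]
    · simp [hB, h]
  have z3 : ∫ z, B i * B j * (z ^ (k - j) * starRingEnd ℂ z ^ (k - i)) ∂μ = 0 := by
    rw [integral_const_mul, hμ.2]
    by_cases h : i ≤ k
    · by_cases h' : j ≤ k
      · rw [if_neg (by omega), mul_zero]
      · simp [hB, h']
    · simp [hB, h]
  have z0 : ∫ z, (k + 2 : ℂ) ^ 2 * (z ^ (i + k) * starRingEnd ℂ z ^ (j + k)) ∂μ = 0 := by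
    rw [integral_const_mul, hμ.2, if_neg (by omega), mul_zero]
  rw [integral_sub, integral_sub, integral_sub, z0, z1, z2, z3]
  · simp
  all_goals exact hμ.1 _ (by fun_prop)

end HasWeightedBergmanMoments

/-- `∑_{l < N} (l + 2) z̄ˡ Xˡ`, a truncation of the derivative of the Szegő kernel. -/
noncomputable def szegoDerivative (N : ℕ) (z : ℂ) : ℂ[X] :=
  ∑ l ∈ range N, monomial l (((l : ℂ) + 2) * starRingEnd ℂ z ^ l)

theorem coeff_szegoDerivative (N : ℕ) (z : ℂ) (k : ℕ) :
    (szegoDerivative N z).coeff k = if k < N then ((k : ℂ) + 2) * starRingEnd ℂ z ^ k else 0 := by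
  simp [szegoDerivative, coeff_monomial]

theorem coeff_mul_X_mul_szegoDerivative {N k : ℕ} (hk : k ≤ N) (a : ℂ[X]) (z : ℂ) :
    (a * (X * szegoDerivative N z)).coeff k
      = ∑ l ∈ range k, (((l : ℂ) + 2) * a.coeff (k - 1 - l)) * starRingEnd ℂ z ^ l := by
  rw [mul_left_comm]
  cases k with
  | zero => simp
  | succ k =>
    rw [coeff_X_mul, mul_comm, coeff_mul, Nat.sum_antidiagonal_eq_sum_range_succ_mk]
    refine sum_congr rfl fun l hl => ?_
    have : l < k + 1 := mem_range.1 hl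
    rw [coeff_szegoDerivative, if_pos (by omega)]
    simp only [Nat.add_sub_cancel]
    ring

theorem coeff_szegoDerivative_mul_sub {N k : ℕ} (hk : k < N) {v : ℂ[X]} (hv : v.natDegree < N) (z : ℂ) :
    (szegoDerivative N z * (C (v.eval z) - v)).coeff k
      = ∑ j ∈ range N, v.coeff j * (((k : ℂ) + 2) * (starRingEnd ℂ z ^ k * z ^ j) -
        (if j ≤ k then ((k - j : ℕ) + 2 : ℂ) * starRingEnd ℂ z ^ (k - j) else 0)) := by
  have h1 : (szegoDerivative N z * v).coeff k
      = ∑ j ∈ range N, v.coeff j *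
        (if j ≤ k then ((k - j : ℕ) + 2 : ℂ) * starRingEnd ℂ z ^ (k - j) else 0) := by
    rw [mul_comm, coeff_mul, Nat.sum_antidiagonal_eq_sum_range_succ_mk]
    simp only [mul_ite, mul_zero]
    rw [← sum_filter]
    have : (range N).filter (fun j => j ≤ k) = range k.succ := by
      ext j; simp only [mem_filter, mem_range]; omega
    rw [this]
    refine sum_congr rfl fun l hl => ?_
    rw [coeff_szegoDerivative, if_pos (by omega)]
  rw [mul_sub, coeff_sub, h1, coeff_mul_C, coeff_szegoDerivative, if_pos hk, eval_eq_sum_range' hv,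
    mul_sum, ← sum_sub_distrib]
  refine sum_congr rfl fun j _ => ?_
  ring

theorem norm_add_sq_le_two (a b : ℂ) : ‖a + b‖ ^ 2 ≤ 2 * ‖a‖ ^ 2 + 2 * ‖b‖ ^ 2 := by
  have h := norm_add_le a b
  have h1 : ‖a + b‖ ^ 2 ≤ (‖a‖ + ‖b‖) ^ 2 := by gcongr
  nlinarith [sq_nonneg (‖a‖ - ‖b‖)]

theorem norm_sub_sq_le_two (a b : ℂ) : ‖a - b‖ ^ 2 ≤ 2 * ‖a‖ ^ 2 + 2 * ‖b‖ ^ 2 := by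
  have := norm_add_sq_le_two a (-b)
  rwa [← sub_eq_add_neg, norm_neg] at this

theorem norm_natCast_add_one_sq (k : ℕ) : ‖(k : ℂ) + 1‖ ^ 2 = ((k : ℝ) + 1) ^ 2 := by
  have := Complex.norm_natCast (k + 1)
  push_cast at this
  rw [this]

theorem sum_range_weighted_sq_norm_coeff_mul_le {f : ℂ[X]} {M : ℝ}
    (hf : ∀ z : ℂ, ‖z‖ ≤ 1 → ‖f.eval z‖ ≤ M) {w : ℕ → ℝ} (hw : Antitone w) (hw0 : ∀ n, 0 ≤ w n)
    (a : ℂ[X]) (n : ℕ) :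
    ∑ l ∈ range n, w l * ‖(f * a).coeff l‖ ^ 2 ≤ M ^ 2 * ∑ l ∈ range n, w l * ‖a.coeff l‖ ^ 2 := by
  have := sum_range_mul_le_of_antitone hw hw0 (x := fun l => ‖(f * a).coeff l‖ ^ 2)
    (y := fun l => M ^ 2 * ‖a.coeff l‖ ^ 2)
    (fun n => by rw [← mul_sum]; exact sum_sq_norm_coeff_mul_le hf a n) n
  rw [mul_sum]
  refine this.trans_eq (sum_congr rfl fun _ _ => by ring)

theorem sum_sq_norm_derivative_mul_le {f : ℂ[X]} {M : ℝ}
    (hf : ∀ z : ℂ, ‖z‖ ≤ 1 → ‖f.eval z‖ ≤ M) (a : ℂ[X]) (N : ℕ) :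
    ∑ k ∈ range N, (1 / ((k : ℝ) + 1) ^ 3) * ‖(derivative f * (X * a)).coeff k‖ ^ 2
      ≤ 4 * M ^ 2 * ∑ k ∈ range N, (1 / ((k : ℝ) + 1)) * ‖a.coeff k‖ ^ 2 := by
  have e : ∀ k : ℕ, (derivative f * (X * a)).coeff k
      = ((k : ℂ) + 1) * (f * a).coeff k - (f * derivative (X * a)).coeff k := by
    intro k
    have : derivative f * (X * a) = derivative (X * (f * a)) - f * derivative (X * a) := by
      rw [mul_left_comm X f a, derivative_mul (f := f)]; ring
    rw [this, coeff_sub, coeff_derivative, coeff_X_mul]; ring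
  have h1 : Antitone fun k : ℕ => 1 / ((k : ℝ) + 1) := fun a b hab => by
    dsimp only; gcongr
  have h3 : Antitone fun k : ℕ => 1 / ((k : ℝ) + 1) ^ 3 := fun a b hab => by
    dsimp only; gcongr
  have k1 := sum_range_weighted_sq_norm_coeff_mul_le hf h1 (fun n => by positivity) a N
  have k3 := sum_range_weighted_sq_norm_coeff_mul_le hf h3 (fun n => by positivity) (derivative (X * a)) N
  have k4 : ∑ l ∈ range N, (1 / ((l : ℝ) + 1) ^ 3) * ‖(derivative (X * a)).coeff l‖ ^ 2
      = ∑ k ∈ range N, (1 / ((k : ℝ) + 1)) * ‖a.coeff k‖ ^ 2 := by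
    refine sum_congr rfl fun k _ => ?_
    rw [coeff_derivative, coeff_X_mul, norm_mul, mul_pow, norm_natCast_add_one_sq]
    field_simp
  rw [k4] at k3
  calc _ ≤ ∑ k ∈ range N, (2 * ((1 / ((k : ℝ) + 1)) * ‖(f * a).coeff k‖ ^ 2)
            + 2 * ((1 / ((k : ℝ) + 1) ^ 3) * ‖(f * derivative (X * a)).coeff k‖ ^ 2)) := by
        refine sum_le_sum fun k _ => ?_
        rw [e]
        have := norm_sub_sq_le_two (((k : ℂ) + 1) * (f * a).coeff k) ((f * derivative (X * a)).coeff k)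
        rw [norm_mul, mul_pow, norm_natCast_add_one_sq] at this
        calc _ ≤ _ := mul_le_mul_of_nonneg_left this (by positivity)
          _ = _ := by field_simp
    _ ≤ _ := by
        rw [sum_add_distrib, ← mul_sum, ← mul_sum]
        linarith

theorem sum_sq_norm_derivative_mul_le_sum_range {f : ℂ[X]} {M : ℝ}
    (hf : ∀ z : ℂ, ‖z‖ ≤ 1 → ‖f.eval z‖ ≤ M) (v : ℂ[X]) {N : ℕ} (hv : v.natDegree < N) :
    ∑ k ∈ range N, (1 / ((k : ℝ) + 1) ^ 3) * ∑ l ∈ range k, ‖(derivative f * v).coeff l‖ ^ 2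
      ≤ 2 * M ^ 2 * ∑ l ∈ range N, ‖v.coeff l‖ ^ 2 := by
  have e : ∀ l, ‖(derivative f * v).coeff l‖ ^ 2
      ≤ 2 * (((l : ℝ) + 1) ^ 2 * ‖(f * v).coeff (l + 1)‖ ^ 2)
        + 2 * ‖(f * derivative v).coeff l‖ ^ 2 := by
    intro l
    have : derivative f * v = derivative (f * v) - f * derivative v := by
      rw [derivative_mul]; ring
    rw [this, coeff_sub, coeff_derivative]
    refine (norm_sub_sq_le_two _ _).trans_eq ?_
    rw [norm_mul, mul_pow, norm_natCast_add_one_sq]; ring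
  have e2 : ∀ k, ∑ l ∈ range k, ‖(derivative f * v).coeff l‖ ^ 2
      ≤ 2 * ∑ l ∈ range k, ((l : ℝ) + 1) ^ 2 * ‖(f * v).coeff (l + 1)‖ ^ 2
        + 2 * M ^ 2 * ∑ l ∈ range k, ((l : ℝ) + 1) ^ 2 * ‖v.coeff (l + 1)‖ ^ 2 := by
    intro k
    have h := sum_sq_norm_coeff_mul_le hf (derivative v) k
    have h' : ∑ l ∈ range k, ‖(derivative v).coeff l‖ ^ 2
        = ∑ l ∈ range k, ((l : ℝ) + 1) ^ 2 * ‖v.coeff (l + 1)‖ ^ 2 :=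
      sum_congr rfl fun l _ => by
        rw [coeff_derivative, norm_mul, mul_pow, norm_natCast_add_one_sq]; ring
    have h2 := sum_le_sum fun l (_ : l ∈ range k) => e l
    rw [sum_add_distrib, ← mul_sum, ← mul_sum] at h2
    rw [h'] at h
    linarith
  have s1 := sum_range_div_cube_mul_le (b := fun l => ‖(f * v).coeff (l + 1)‖ ^ 2) (fun _ => by positivity) N
  have s2 := sum_range_div_cube_mul_le (b := fun l => ‖v.coeff (l + 1)‖ ^ 2) (fun _ => by positivity) N
  have t2 : ∑ l ∈ range (N + 1), ‖v.coeff l‖ ^ 2 = ∑ l ∈ range N, ‖v.coeff l‖ ^ 2 := by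
    rw [sum_range_succ, coeff_eq_zero_of_natDegree_lt hv]; simp
  have t1 := sum_sq_norm_coeff_mul_le hf v (N + 1)
  rw [t2] at t1
  rw [sum_range_succ'] at t1 t2
  have t3 : 0 ≤ ‖(f * v).coeff 0‖ ^ 2 := by positivity
  have t4 : 0 ≤ ‖v.coeff 0‖ ^ 2 := by positivity
  have hM : 0 ≤ M ^ 2 := sq_nonneg M
  calc _ ≤ ∑ k ∈ range N, (2 * ((1 / ((k : ℝ) + 1) ^ 3) * ∑ l ∈ range k, ((l : ℝ) + 1) ^ 2 * ‖(f * v).coeff (l + 1)‖ ^ 2)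
        + 2 * M ^ 2 * ((1 / ((k : ℝ) + 1) ^ 3) * ∑ l ∈ range k, ((l : ℝ) + 1) ^ 2 * ‖v.coeff (l + 1)‖ ^ 2)) := by
        refine sum_le_sum fun k _ => ?_
        exact (mul_le_mul_of_nonneg_left (e2 k) (by positivity)).trans_eq (by ring)
    _ ≤ _ := by
        rw [sum_add_distrib, ← mul_sum, ← mul_sum]
        have s3 : ∑ k ∈ range N, (1 / ((k : ℝ) + 1) ^ 3) * ∑ l ∈ range k, ((l : ℝ) + 1) ^ 2 * ‖v.coeff (l + 1)‖ ^ 2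
          ≤ 1 / 2 * ∑ l ∈ range N, ‖v.coeff l‖ ^ 2 := by linarith
        have := mul_le_mul_of_nonneg_left s3 hM
        linarith

namespace HasWeightedBergmanMoments

theorem sum_integral_commuting_le {μ : Measure ℂ} (hμ : HasWeightedBergmanMoments μ)
    {f : ℂ[X]} {M : ℝ}
    (hf : ∀ z : ℂ, ‖z‖ ≤ 1 → ‖f.eval z‖ ≤ M) (v : ℂ[X]) {N : ℕ} (hv : v.natDegree < N) :
    ∑ k ∈ range N, (1 / ((k : ℝ) + 1) ^ 3) *
        ∫ z, ‖((derivative f * v) * (X * szegoDerivative N z)).coeff k‖ ^ 2 ∂μ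
      ≤ 4 * M ^ 2 * ∑ l ∈ range N, ‖v.coeff l‖ ^ 2 := by
  have h := sum_sq_norm_derivative_mul_le_sum_range hf v hv
  suffices ∀ k ∈ range N,
      (1 / ((k : ℝ) + 1) ^ 3) * ∫ z, ‖((derivative f * v) * (X * szegoDerivative N z)).coeff k‖ ^ 2 ∂μ
      ≤ 2 * ((1 / ((k : ℝ) + 1) ^ 3) * ∑ l ∈ range k, ‖(derivative f * v).coeff l‖ ^ 2) by
    refine (sum_le_sum this).trans ?_
    rw [← mul_sum]; linarith
  intro k hk
  rw [mul_left_comm]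
  refine mul_le_mul_of_nonneg_left ?_ (by positivity)
  simp_rw [coeff_mul_X_mul_szegoDerivative (mem_range.1 hk).le]
  rw [hμ.integral_sq_norm_sum_conj_pow, ← sum_range_reflect (fun l => ‖(derivative f * v).coeff l‖ ^ 2),
    mul_sum]
  refine sum_le_sum fun l _ => ?_
  have : ‖(l : ℂ) + 2‖ = l + 2 := by
    have := Complex.norm_natCast (l + 2); push_cast at this; exact this
  rw [norm_mul, mul_pow, this, mul_comm (((l : ℝ) + 2) ^ 2), mul_assoc, mul_comm]
  refine mul_le_mul_of_nonneg_right ?_ (by positivity)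
  rw [mul_one_div, div_le_iff₀ (by positivity)]
  nlinarith [(Nat.cast_nonneg l : (0 : ℝ) ≤ l)]

theorem sum_integral_commutator_le {μ : Measure ℂ} (hμ : HasWeightedBergmanMoments μ)
    (v : ℂ[X]) {N : ℕ} (hv : v.natDegree < N) :
    ∑ k ∈ range N, (1 / ((k : ℝ) + 1)) *
        ∫ z, ‖(szegoDerivative N z * (C (v.eval z) - v)).coeff k‖ ^ 2 ∂μ
      ≤ 5 * ∑ l ∈ range N, ‖v.coeff l‖ ^ 2 := by
  calc _ ≤ ∑ k ∈ range N, ∑ j ∈ range N, ‖v.coeff j‖ ^ 2 *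
        (if j ≤ k then 3 * (j : ℝ) / ((k : ℝ) + 1) ^ 2 else 2 / (j : ℝ)) := by
        refine sum_le_sum fun k hk => ?_
        simp_rw [coeff_szegoDerivative_mul_sub (mem_range.1 hk) hv]
        rw [integral_sq_norm_sum_of_orthogonal]
        · rw [mul_sum]
          refine sum_le_sum fun j _ => ?_
          rw [mul_left_comm]
          refine mul_le_mul_of_nonneg_left ?_ (by positivity)
          refine (mul_le_mul_of_nonneg_left (hμ.integral_sq_norm_kernel_le j k) (by positivity)).trans_eq ?_
          split_ifs <;> field_simp
        · intro i _ j _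
          refine hμ.1 _ ?_
          split_ifs <;> fun_prop
        · exact fun i _ j _ hij => hμ.integral_kernel_mul_conj_eq_zero k hij
    _ ≤ _ := by
        rw [sum_comm, mul_sum]
        refine sum_le_sum fun j _ => ?_
        rw [← mul_sum, mul_comm]
        exact mul_le_mul_of_nonneg_right (sum_range_kernel_le j N) (by positivity)

theorem continuous_coeff_mul_szegoDerivative (a : ℂ[X]) (N k : ℕ) :
    Continuous fun z => (a * (X * szegoDerivative N z)).coeff k := by
  have : ∀ z, (a * (X * szegoDerivative N z)).coeff k =
      ∑ l ∈ range N, (a * X * X ^ l).coeff k * (((l : ℂ) + 2) * starRingEnd ℂ z ^ l) := by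
    intro z
    rw [szegoDerivative, ← mul_assoc, mul_sum, finsetSum_coeff]
    refine sum_congr rfl fun l _ => ?_
    rw [← C_mul_X_pow_eq_monomial, mul_left_comm, coeff_C_mul, mul_comm]
  simp_rw [this]
  fun_prop

theorem continuous_coeff_szegoDerivative_mul_sub {N k : ℕ} (hk : k < N) {v : ℂ[X]} (hv : v.natDegree < N) :
    Continuous fun z => (szegoDerivative N z * (C (v.eval z) - v)).coeff k := by
  simp_rw [coeff_szegoDerivative_mul_sub hk hv]
  refine continuous_finsetSum _ fun j _ => ?_
  split_ifs <;> fun_prop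

theorem integral_sum_sq_norm_mul_le {μ : Measure ℂ} (hμ : HasWeightedBergmanMoments μ)
    {f : ℂ[X]} {M : ℝ}
    (hf : ∀ z : ℂ, ‖z‖ ≤ 1 → ‖f.eval z‖ ≤ M) (v : ℂ[X]) {N : ℕ} (hv : v.natDegree < N) :
    ∫ z, (∑ k ∈ range N, (1 / ((k : ℝ) + 1) ^ 3) *
        ‖(derivative f * (X * szegoDerivative N z)).coeff k‖ ^ 2) * ‖v.eval z‖ ^ 2 ∂μ
      ≤ 64 * M ^ 2 * ∑ l ∈ range N, ‖v.coeff l‖ ^ 2 := by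
  have hc := continuous_coeff_mul_szegoDerivative
  have hY := hμ.sum_integral_commuting_le hf v hv
  have hZ := hμ.sum_integral_commutator_le v hv
  have hpt : ∀ z, (∑ k ∈ range N, (1 / ((k : ℝ) + 1) ^ 3) *
        ‖(derivative f * (X * szegoDerivative N z)).coeff k‖ ^ 2) * ‖v.eval z‖ ^ 2
      ≤ 2 * ∑ k ∈ range N, (1 / ((k : ℝ) + 1) ^ 3) *
          ‖((derivative f * v) * (X * szegoDerivative N z)).coeff k‖ ^ 2
        + 8 * M ^ 2 * ∑ k ∈ range N, (1 / ((k : ℝ) + 1)) *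
          ‖(szegoDerivative N z * (C (v.eval z) - v)).coeff k‖ ^ 2 := by
    intro z
    have hz := sum_sq_norm_derivative_mul_le hf (szegoDerivative N z * (C (v.eval z) - v)) N
    have h1 : (∑ k ∈ range N, (1 / ((k : ℝ) + 1) ^ 3) *
        ‖(derivative f * (X * szegoDerivative N z)).coeff k‖ ^ 2) * ‖v.eval z‖ ^ 2
      ≤ ∑ k ∈ range N, (2 * ((1 / ((k : ℝ) + 1) ^ 3) *
          ‖((derivative f * v) * (X * szegoDerivative N z)).coeff k‖ ^ 2)
        + 2 * ((1 / ((k : ℝ) + 1) ^ 3) *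
          ‖(derivative f * (X * (szegoDerivative N z * (C (v.eval z) - v)))).coeff k‖ ^ 2)) := by
      rw [sum_mul]
      refine sum_le_sum fun k _ => ?_
      have e : (derivative f * (X * szegoDerivative N z)).coeff k * v.eval z
          = ((derivative f * v) * (X * szegoDerivative N z)).coeff k
            + (derivative f * (X * (szegoDerivative N z * (C (v.eval z) - v)))).coeff k := by
        rw [← coeff_mul_C, ← coeff_add]; congr 1; ring
      rw [mul_assoc, ← mul_pow, ← norm_mul, e]
      refine (mul_le_mul_of_nonneg_left (norm_add_sq_le_two _ _) (by positivity)).trans_eq ?_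
      ring
    rw [sum_add_distrib, ← mul_sum, ← mul_sum] at h1
    linarith
  have hi1 : ∀ k ∈ range N, Integrable (fun z => (1 / ((k : ℝ) + 1) ^ 3) *
          ‖((derivative f * v) * (X * szegoDerivative N z)).coeff k‖ ^ 2) μ := fun k _ =>
    hμ.integrable_real (((hc _ N k).norm.pow 2).const_mul _)
  have hi2 : ∀ k ∈ range N, Integrable (fun z => (1 / ((k : ℝ) + 1)) *
          ‖(szegoDerivative N z * (C (v.eval z) - v)).coeff k‖ ^ 2) μ := fun k hk =>
    hμ.integrable_real (((continuous_coeff_szegoDerivative_mul_sub (mem_range.1 hk) hv).norm.pow 2).const_mul _)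
  refine (integral_mono (hμ.integrable_real ?_) ?_ hpt).trans ?_
  · refine Continuous.mul (continuous_finsetSum _ fun k _ => ((hc _ N k).norm.pow 2).const_mul _) ?_
    fun_prop
  · exact ((integrable_finsetSum _ hi1).const_mul _).add ((integrable_finsetSum _ hi2).const_mul _)
  · rw [integral_add ((integrable_finsetSum _ hi1).const_mul _) ((integrable_finsetSum _ hi2).const_mul _),
      integral_const_mul, integral_const_mul, integral_finsetSum _ hi1, integral_finsetSum _ hi2]
    simp_rw [integral_const_mul]
    have hv0 : 0 ≤ M ^ 2 * ∑ l ∈ range N, ‖v.coeff l‖ ^ 2 := by positivity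
    have := mul_le_mul_of_nonneg_left hZ (by positivity : 0 ≤ 8 * M ^ 2)
    linarith

end HasWeightedBergmanMoments

/-- A family of matrices whose linear combinations have norm at most `√2` times the `ℓ²` norm of
the coefficients. -/
def IsRowBounded {ι : Type*} [Fintype ι] (N : ℕ) (W : ℕ → Matrix ι ι ℂ) : Prop :=
  ∀ (c : ℕ → ℂ) (x y : ι → ℂ),
    ‖∑ k ∈ range N, c k * ∑ a, ∑ b, W k a b * (x a * y b)‖ ^ 2
      ≤ 2 * (∑ k ∈ range N, ‖c k‖ ^ 2) * (∑ a, ‖x a‖ ^ 2) * (∑ b, ‖y b‖ ^ 2)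

theorem IsRowBounded.norm_le {ι : Type*} [Fintype ι] {N : ℕ} {W : ℕ → Matrix ι ι ℂ}
    (hW : IsRowBounded N W) {s : ℝ} (hs : 0 < s) (c : ℕ → ℂ) (x y : ι → ℂ) :
    ‖∑ k ∈ range N, c k * ∑ a, ∑ b, W k a b * (x a * y b)‖
      ≤ s * ∑ a, ‖x a‖ ^ 2 + s⁻¹ * ((∑ k ∈ range N, ‖c k‖ ^ 2) * ∑ b, ‖y b‖ ^ 2) := by
  have h := hW c x y
  set A := ∑ k ∈ range N, ‖c k‖ ^ 2
  set P := ∑ a, ‖x a‖ ^ 2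
  set Q := ∑ b, ‖y b‖ ^ 2
  have hA : 0 ≤ A := sum_nonneg fun _ _ => by positivity
  have hP : 0 ≤ P := sum_nonneg fun _ _ => by positivity
  have hQ : 0 ≤ Q := sum_nonneg fun _ _ => by positivity
  refine abs_le_of_sq_le_sq' ?_ (by positivity) |>.2
  have e : (s * P) * (s⁻¹ * (A * Q)) = A * P * Q := by field_simp
  have : 0 ≤ A * P * Q := by positivity
  nlinarith [sq_nonneg (s * P - s⁻¹ * (A * Q))]

theorem IsRowBounded.norm_le' {ι : Type*} [Fintype ι] {N : ℕ} {W : ℕ → Matrix ι ι ℂ}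
    (hW : IsRowBounded N W) {s : ℝ} (hs : 0 < s) (c : ℕ → ℂ) (x y : ι → ℂ) :
    ‖∑ k ∈ range N, c k * ∑ a, ∑ b, W k a b * (x a * y b)‖
      ≤ s * ∑ b, ‖y b‖ ^ 2 + s⁻¹ * ((∑ k ∈ range N, ‖c k‖ ^ 2) * ∑ a, ‖x a‖ ^ 2) := by
  have h := hW c x y
  set A := ∑ k ∈ range N, ‖c k‖ ^ 2
  set P := ∑ a, ‖x a‖ ^ 2
  set Q := ∑ b, ‖y b‖ ^ 2
  have hA : 0 ≤ A := sum_nonneg fun _ _ => by positivity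
  have hP : 0 ≤ P := sum_nonneg fun _ _ => by positivity
  have hQ : 0 ≤ Q := sum_nonneg fun _ _ => by positivity
  refine abs_le_of_sq_le_sq' ?_ (by positivity) |>.2
  have e : (s * Q) * (s⁻¹ * (A * P)) = A * P * Q := by field_simp
  have : 0 ≤ A * P * Q := by positivity
  nlinarith [sq_nonneg (s * Q - s⁻¹ * (A * P))]

theorem sum_sq_norm_coeff_succ_le (u : ℂ[X]) (N : ℕ) :
    ∑ l ∈ range N, ‖u.coeff (l + 1)‖ ^ 2 ≤ ∑ l ∈ range (N + 1), ‖u.coeff l‖ ^ 2 := by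
  rw [sum_range_succ']
  have : 0 ≤ ‖u.coeff 0‖ ^ 2 := by positivity
  linarith

theorem sum_sq_norm_coeff_derivative_le {f : ℂ[X]} {M : ℝ}
    (hf : ∀ z : ℂ, ‖z‖ ≤ 1 → ‖f.eval z‖ ≤ M) (N : ℕ) :
    ∑ k ∈ range N, (1 / ((k : ℝ) + 1) ^ 3) * ‖(derivative f).coeff k‖ ^ 2 ≤ M ^ 2 := by
  have h := sum_sq_norm_coeff_mul_le hf 1 (N + 1)
  have h1 : ∑ l ∈ range (N + 1), ‖(1 : ℂ[X]).coeff l‖ ^ 2 = 1 := by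
    rw [sum_range_succ']
    simp [coeff_one]
  rw [h1, mul_one, mul_one] at h
  refine le_trans (sum_le_sum fun k _ => ?_) ((sum_sq_norm_coeff_succ_le f N).trans h)
  rw [coeff_derivative, norm_mul, mul_pow, norm_natCast_add_one_sq, mul_comm, mul_assoc]
  refine mul_le_of_le_one_right (by positivity) ?_
  rw [mul_one_div, div_le_one (by positivity)]
  exact pow_le_pow_right₀ (by linarith [(Nat.cast_nonneg k : (0 : ℝ) ≤ k)]) (by norm_num)

namespace HasWeightedBergmanMoments

theorem integral_sq_norm_derivative_le {μ : Measure ℂ} (hμ : HasWeightedBergmanMoments μ)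
    (u : ℂ[X]) {N : ℕ} (hu : u.natDegree < N) :
    ∫ z, ‖(derivative u).eval z‖ ^ 2 ∂μ ≤ ∑ l ∈ range N, ‖u.coeff l‖ ^ 2 := by
  have hd : (derivative u).natDegree < N := lt_of_le_of_lt (natDegree_derivative_le u) (by omega)
  simp_rw [eval_eq_sum_range' hd]
  rw [hμ.integral_sq_norm_sum_pow]
  have t2 : ∑ l ∈ range (N + 1), ‖u.coeff l‖ ^ 2 = ∑ l ∈ range N, ‖u.coeff l‖ ^ 2 := by
    rw [sum_range_succ, coeff_eq_zero_of_natDegree_lt hu]; simp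
  rw [← t2]
  refine le_trans (sum_le_sum fun k _ => ?_) (sum_sq_norm_coeff_succ_le u N)
  rw [coeff_derivative, norm_mul, mul_pow, norm_natCast_add_one_sq, mul_assoc]
  refine mul_le_of_le_one_right (by positivity) ?_
  rw [mul_one_div, div_le_one (by positivity)]
  nlinarith [(Nat.cast_nonneg k : (0 : ℝ) ≤ k)]

theorem integral_eval_mul_conj_pow {μ : Measure ℂ} (hμ : HasWeightedBergmanMoments μ)
    (p : ℂ[X]) (l : ℕ) :
    ∫ z, p.eval z * starRingEnd ℂ z ^ l ∂μ = p.coeff l * (1 / (((l : ℂ) + 1) * (l + 2))) := by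
  have hp : p.natDegree < max (p.natDegree + 1) (l + 1) := by
    have := le_max_left (p.natDegree + 1) (l + 1); omega
  simp_rw [eval_eq_sum_range' hp, sum_mul, mul_assoc]
  rw [integral_finsetSum]
  · simp_rw [integral_const_mul, hμ.2]
    rw [sum_eq_single l]
    · simp
    · intro b _ hb; simp [hb]
    · intro h
      have := le_max_right (p.natDegree + 1) (l + 1)
      simp only [mem_range] at h; omega
  · exact fun i _ => hμ.1 _ (by fun_prop)

theorem coeff_mul_eq_integral {μ : Measure ℂ} (hμ : HasWeightedBergmanMoments μ)
    (q P : ℂ[X]) {k N : ℕ} (hk : k < N) :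
    (q * P).coeff k = q.coeff k * P.coeff 0 +
      ∫ z, (derivative P).eval z * (q * (X * szegoDerivative N z)).coeff k ∂μ := by
  simp_rw [coeff_mul_X_mul_szegoDerivative hk.le, mul_sum]
  have e : ∀ (z : ℂ) (l : ℕ), (derivative P).eval z * ((((l : ℂ) + 2) * q.coeff (k - 1 - l)) * starRingEnd ℂ z ^ l)
      = (((l : ℂ) + 2) * q.coeff (k - 1 - l)) * ((derivative P).eval z * starRingEnd ℂ z ^ l) := by
    intros; ring
  simp_rw [e]
  rw [integral_finsetSum]
  · simp_rw [integral_const_mul, hμ.integral_eval_mul_conj_pow]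
    rw [mul_comm, coeff_mul, Nat.sum_antidiagonal_eq_sum_range_succ_mk, sum_range_succ', add_comm]
    congr 1
    · simp [mul_comm]
    · refine sum_congr rfl fun l hl => ?_
      have h1 : (l : ℂ) + 1 ≠ 0 := by exact_mod_cast Nat.succ_ne_zero l
      have h2 : (l : ℂ) + 2 ≠ 0 := by exact_mod_cast Nat.succ_ne_zero (l + 1)
      rw [coeff_derivative, show k - (l + 1) = k - 1 - l by omega]
      field_simp
  · exact fun i _ => hμ.1 _ (by fun_prop)

theorem integral_norm_add_le {μ : Measure ℂ} (hμ : HasWeightedBergmanMoments μ)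
    {ι : Type*} [Fintype ι] {N : ℕ} {W : ℕ → Matrix ι ι ℂ}
    (hW : IsRowBounded N W) {g : ℕ → ℝ} (hg : ∀ k, g k ^ 2 = 1 / ((k : ℝ) + 1) ^ 3)
    {f : ℂ[X]} {M : ℝ} (hM : 0 < M) (hf : ∀ z : ℂ, ‖z‖ ≤ 1 → ‖f.eval z‖ ≤ M)
    {u v : ι → ℂ[X]} (hu : ∀ a, (u a).natDegree < N) (hv : ∀ a, (v a).natDegree < N) :
    ‖∫ z, ∑ k ∈ range N, ((g k : ℂ) * (derivative f * (X * szegoDerivative N z)).coeff k) *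
      ∑ a, ∑ b, W k a b * ((derivative (u a * v b)).eval z) ∂μ‖
      ≤ 16 * M * (∑ a, ∑ i ∈ range N, ‖(u a).coeff i‖ ^ 2 + ∑ b, ∑ i ∈ range N, ‖(v b).coeff i‖ ^ 2) := by
  set K : ℂ → ℝ := fun z => ∑ k ∈ range N, (1 / ((k : ℝ) + 1) ^ 3) *
    ‖(derivative f * (X * szegoDerivative N z)).coeff k‖ ^ 2 with hK
  have hKc : Continuous K := continuous_finsetSum _ fun k _ =>
    ((continuous_coeff_mul_szegoDerivative _ N k).norm.pow 2).const_mul _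
  have hpt : ∀ z, ‖∑ k ∈ range N, ((g k : ℂ) * (derivative f * (X * szegoDerivative N z)).coeff k) *
      ∑ a, ∑ b, W k a b * ((derivative (u a * v b)).eval z)‖
      ≤ (∑ a, (8 * M) * ‖(derivative (u a)).eval z‖ ^ 2 + ∑ b, (8 * M)⁻¹ * (K z * ‖(v b).eval z‖ ^ 2))
        + (∑ b, (8 * M) * ‖(derivative (v b)).eval z‖ ^ 2 + ∑ a, (8 * M)⁻¹ * (K z * ‖(u a).eval z‖ ^ 2)) := by
    intro z
    have hc : ∑ k ∈ range N, ‖(g k : ℂ) * (derivative f * (X * szegoDerivative N z)).coeff k‖ ^ 2 = K z :=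
      sum_congr rfl fun k _ => by
        rw [norm_mul, mul_pow, Complex.norm_real, Real.norm_eq_abs, sq_abs, hg]
    have h1 := hW.norm_le (s := 8 * M) (by positivity)
      (fun k => (g k : ℂ) * (derivative f * (X * szegoDerivative N z)).coeff k)
      (fun a => (derivative (u a)).eval z) (fun b => (v b).eval z)
    have h2 := hW.norm_le' (s := 8 * M) (by positivity)
      (fun k => (g k : ℂ) * (derivative f * (X * szegoDerivative N z)).coeff k)
      (fun a => (u a).eval z) (fun b => (derivative (v b)).eval z)
    rw [hc] at h1 h2
    have e : ∑ k ∈ range N, ((g k : ℂ) * (derivative f * (X * szegoDerivative N z)).coeff k) *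
          ∑ a, ∑ b, W k a b * ((derivative (u a * v b)).eval z)
        = ∑ k ∈ range N, ((g k : ℂ) * (derivative f * (X * szegoDerivative N z)).coeff k) *
          ∑ a, ∑ b, W k a b * ((derivative (u a)).eval z * (v b).eval z)
        + ∑ k ∈ range N, ((g k : ℂ) * (derivative f * (X * szegoDerivative N z)).coeff k) *
          ∑ a, ∑ b, W k a b * ((u a).eval z * (derivative (v b)).eval z) := by
      simp only [derivative_mul, eval_add, eval_mul, mul_add, sum_add_distrib]
    rw [e]
    refine (norm_add_le _ _).trans ((add_le_add h1 h2).trans_eq ?_)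
    simp only [mul_sum]
  have hi1 : ∀ w : ι → ℂ[X], ∀ a ∈ (univ : Finset ι), Integrable (fun z => (8 * M) * ‖(derivative (w a)).eval z‖ ^ 2) μ :=
    fun w a _ => hμ.integrable_real (by fun_prop)
  have hi2 : ∀ w : ι → ℂ[X], ∀ a ∈ (univ : Finset ι), Integrable (fun z => (8 * M)⁻¹ * (K z * ‖(w a).eval z‖ ^ 2)) μ :=
    fun w a _ => hμ.integrable_real (by fun_prop)
  have b1 : ∀ w : ι → ℂ[X], (∀ a, (w a).natDegree < N) →
      ∫ z, ∑ a, (8 * M) * ‖(derivative (w a)).eval z‖ ^ 2 ∂μ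
      ≤ 8 * M * ∑ a, ∑ i ∈ range N, ‖(w a).coeff i‖ ^ 2 := by
    intro w hw
    rw [integral_finsetSum _ (hi1 w), mul_sum]
    refine sum_le_sum fun a _ => ?_
    rw [integral_const_mul]
    exact mul_le_mul_of_nonneg_left (hμ.integral_sq_norm_derivative_le _ (hw a)) (by positivity)
  have b2 : ∀ w : ι → ℂ[X], (∀ a, (w a).natDegree < N) →
      ∫ z, ∑ a, (8 * M)⁻¹ * (K z * ‖(w a).eval z‖ ^ 2) ∂μ
      ≤ 8 * M * ∑ a, ∑ i ∈ range N, ‖(w a).coeff i‖ ^ 2 := by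
    intro w hw
    rw [integral_finsetSum _ (hi2 w), mul_sum]
    refine sum_le_sum fun a _ => ?_
    rw [integral_const_mul]
    refine (mul_le_mul_of_nonneg_left (hμ.integral_sum_sq_norm_mul_le hf _ (hw a)) (by positivity)).trans_eq ?_
    field_simp
    ring
  have j1 := fun w => integrable_finsetSum _ (hi1 w)
  have j2 := fun w => integrable_finsetSum _ (hi2 w)
  refine (norm_integral_le_of_norm_le (((j1 u).add (j2 v)).add ((j1 v).add (j2 u)))
    (Filter.Eventually.of_forall hpt)).trans ?_
  rw [integral_add' ((j1 u).add (j2 v)) ((j1 v).add (j2 u)), integral_add' (j1 u) (j2 v),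
    integral_add' (j1 v) (j2 u)]
  have := b1 u hu
  have := b1 v hv
  have := b2 u hu
  have := b2 v hv
  linarith

theorem norm_sum_coeff_derivative_mul_le {μ : Measure ℂ} (hμ : HasWeightedBergmanMoments μ)
    {ι : Type*} [Fintype ι] {N : ℕ} {W : ℕ → Matrix ι ι ℂ}
    (hW : IsRowBounded N W) {g : ℕ → ℝ} (hg : ∀ k, g k ^ 2 = 1 / ((k : ℝ) + 1) ^ 3)
    {f : ℂ[X]} {M : ℝ} (hM : 0 < M) (hf : ∀ z : ℂ, ‖z‖ ≤ 1 → ‖f.eval z‖ ≤ M)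
    {u v : ι → ℂ[X]} (hu : ∀ a, (u a).natDegree < N) (hv : ∀ a, (v a).natDegree < N) :
    ‖∑ k ∈ range N, (g k : ℂ) * ∑ a, ∑ b, W k a b * (derivative f * (u a * v b)).coeff k‖
      ≤ 17 * M * (∑ a, ∑ i ∈ range N, ‖(u a).coeff i‖ ^ 2 + ∑ b, ∑ i ∈ range N, ‖(v b).coeff i‖ ^ 2) := by
  have h0 := hW.norm_le hM (fun k => (g k : ℂ) * (derivative f).coeff k)
    (fun a => (u a).coeff 0) (fun b => (v b).coeff 0)
  have h1 := hμ.integral_norm_add_le hW hg hM hf hu hv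
  have hc : ∑ k ∈ range N, ‖(g k : ℂ) * (derivative f).coeff k‖ ^ 2 ≤ M ^ 2 := by
    refine le_of_eq_of_le (sum_congr rfl fun k _ => ?_) (sum_sq_norm_coeff_derivative_le hf N)
    rw [norm_mul, mul_pow, Complex.norm_real, Real.norm_eq_abs, sq_abs, hg]
  have hw : ∀ w : ι → ℂ[X], (∀ a, (w a).natDegree < N) →
      ∑ a, ‖(w a).coeff 0‖ ^ 2 ≤ ∑ a, ∑ i ∈ range N, ‖(w a).coeff i‖ ^ 2 := fun w hw =>
    sum_le_sum fun a _ => single_le_sum (f := fun i => ‖(w a).coeff i‖ ^ 2) (fun _ _ => by positivity)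
      (mem_range.2 (by have := hw a; omega))
  have hu0 := hw u hu
  have hv0 := hw v hv
  have e : ∑ k ∈ range N, (g k : ℂ) * ∑ a, ∑ b, W k a b * (derivative f * (u a * v b)).coeff k
      = ∑ k ∈ range N, ((g k : ℂ) * (derivative f).coeff k) *
          ∑ a, ∑ b, W k a b * ((u a).coeff 0 * (v b).coeff 0)
        + ∫ z, ∑ k ∈ range N, ((g k : ℂ) * (derivative f * (X * szegoDerivative N z)).coeff k) *
      ∑ a, ∑ b, W k a b * ((derivative (u a * v b)).eval z) ∂μ := by
    have hcc := continuous_coeff_mul_szegoDerivative (derivative f) N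
    have hI : ∀ k a b, Integrable (fun z => ((g k : ℂ) * (derivative f * (X * szegoDerivative N z)).coeff k) *
        (W k a b * ((derivative (u a * v b)).eval z))) μ := fun k a b => by
      have := hcc k
      exact hμ.1 _ (by fun_prop)
    simp_rw [mul_sum]
    rw [integral_finsetSum _ fun k _ => integrable_finsetSum _ fun a _ =>
      integrable_finsetSum _ fun b _ => hI k a b, ← sum_add_distrib]
    refine sum_congr rfl fun k hk => ?_
    rw [integral_finsetSum _ fun a _ => integrable_finsetSum _ fun b _ => hI k a b, ← sum_add_distrib]
    refine sum_congr rfl fun a _ => ?_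
    rw [integral_finsetSum _ fun b _ => hI k a b, ← sum_add_distrib]
    refine sum_congr rfl fun b _ => ?_
    rw [hμ.coeff_mul_eq_integral _ _ (mem_range.1 hk), mul_coeff_zero]
    have e' : ∀ z, ((g k : ℂ) * (derivative f * (X * szegoDerivative N z)).coeff k) *
        (W k a b * ((derivative (u a * v b)).eval z))
        = ((g k : ℂ) * W k a b) * ((derivative (u a * v b)).eval z *
          (derivative f * (X * szegoDerivative N z)).coeff k) := fun z => by ring
    simp_rw [e']
    rw [integral_const_mul]
    ring
  rw [e]
  refine (norm_add_le _ _).trans ?_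
  have hY : 0 ≤ ∑ b, ‖(v b).coeff 0‖ ^ 2 := sum_nonneg fun _ _ => by positivity
  have h2 : M⁻¹ * ((∑ k ∈ range N, ‖(g k : ℂ) * (derivative f).coeff k‖ ^ 2) * ∑ b, ‖(v b).coeff 0‖ ^ 2)
      ≤ M * ∑ b, ∑ i ∈ range N, ‖(v b).coeff i‖ ^ 2 := by
    calc _ ≤ M⁻¹ * (M ^ 2 * ∑ b, ∑ i ∈ range N, ‖(v b).coeff i‖ ^ 2) := by gcongr
      _ = _ := by field_simp
  have h3 := mul_le_mul_of_nonneg_left hu0 hM.le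
  linarith

end HasWeightedBergmanMoments

theorem exists_anticommuting_family (N : ℕ) :
    ∃ (ι : Type) (_ : Fintype ι) (_ : DecidableEq ι) (_ : Nonempty ι) (U : ℕ → Matrix ι ι ℂ),
      (∀ i, (U i)ᴴ = U i) ∧ (∀ i, (U i)ᵀ = U i) ∧
      ∀ i < N, ∀ j < N, U i * U j + U j * U i = if i = j then 2 else 0 := by
  induction N with
  | zero =>
    exact ⟨Unit, inferInstance, inferInstance, inferInstance, fun _ => 0, by simp, by simp, by simp⟩
  | succ N ih =>
    obtain ⟨ι, _, _, _, U, h1, h2, h3⟩ := ih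
    refine ⟨ι ⊕ ι, inferInstance, inferInstance, inferInstance,
      fun i => if i < N then fromBlocks (U i) 0 0 (-U i) else fromBlocks 0 1 1 0, ?_, ?_, ?_⟩
    · intro i
      dsimp only
      split_ifs <;> simp [fromBlocks_conjTranspose, h1]
    · intro i
      dsimp only
      split_ifs <;> simp [fromBlocks_transpose, h2]
    · have two : (fromBlocks 2 0 0 2 : Matrix (ι ⊕ ι) (ι ⊕ ι) ℂ) = 2 := by
        rw [← one_add_one_eq_two, ← one_add_one_eq_two, ← fromBlocks_one, fromBlocks_add]
        simp
      intro i hi j hj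
      by_cases hi' : i < N <;> by_cases hj' : j < N
      · simp only [hi', hj', if_true, fromBlocks_multiply, fromBlocks_add]
        simp only [mul_zero, zero_mul, add_zero, zero_add, neg_mul_neg, h3 i hi' j hj']
        split_ifs
        · exact two
        · simp
      · have : i ≠ j := by omega
        simp [hi', hj', this, fromBlocks_multiply, fromBlocks_add]
      · have : i ≠ j := by omega
        simp [hi', hj', this, fromBlocks_multiply, fromBlocks_add]
      · have : i = j := by omega
        subst this
        simp only [hi', if_false, if_true, fromBlocks_multiply, fromBlocks_add]
        simp only [mul_zero, add_zero, zero_add, mul_one, one_add_one_eq_two]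
        exact two

theorem sum_sq_norm_mulVec_real_combination {ι : Type*} [Fintype ι] [DecidableEq ι] {N : ℕ}
    {U : ℕ → Matrix ι ι ℂ} (h1 : ∀ i, (U i)ᴴ = U i)
    (h3 : ∀ i < N, ∀ j < N, U i * U j + U j * U i = if i = j then 2 else 0) (s : ℕ → ℝ) (y : ι → ℂ) :
    ∑ a, ‖((∑ k ∈ range N, (s k : ℂ) • U k) *ᵥ y) a‖ ^ 2
      = (∑ k ∈ range N, s k ^ 2) * ∑ a, ‖y a‖ ^ 2 := by
  set A := ∑ k ∈ range N, (s k : ℂ) • U k with hA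
  have hAH : Aᴴ = A := by
    simp [hA, conjTranspose_sum, conjTranspose_smul, h1]
  have hAA : A * A = ((∑ k ∈ range N, s k ^ 2 : ℝ) : ℂ) • (1 : Matrix ι ι ℂ) := by
    have e : A * A + A * A = (2 : ℂ) • (((∑ k ∈ range N, s k ^ 2 : ℝ) : ℂ) • (1 : Matrix ι ι ℂ)) := by
      have e1 : A * A = ∑ i ∈ range N, ∑ j ∈ range N, ((s i : ℂ) * s j) • (U i * U j) := by
        simp_rw [hA, sum_mul_sum, smul_mul_smul_comm]
      have e2 : A * A = ∑ i ∈ range N, ∑ j ∈ range N, ((s i : ℂ) * s j) • (U j * U i) := by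
        rw [e1, sum_comm]
        simp_rw [mul_comm]
      nth_rw 1 [e1]
      rw [e2]
      simp_rw [← sum_add_distrib, ← smul_add]
      rw [Complex.ofReal_sum, sum_smul, smul_sum]
      refine sum_congr rfl fun i hi => ?_
      rw [sum_eq_single_of_mem i hi]
      · rw [h3 i (mem_range.1 hi) i (mem_range.1 hi), if_pos rfl, smul_smul, ← one_add_one_eq_two,
          smul_add, ← add_smul]
        push_cast; ring_nf
      · intro j hj hji
        rw [h3 i (mem_range.1 hi) j (mem_range.1 hj), if_neg (Ne.symm hji), smul_zero]
    rw [← two_smul ℂ] at e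
    exact smul_right_injective _ (two_ne_zero) e
  have key : ∀ w : ι → ℂ, ((∑ a, ‖w a‖ ^ 2 : ℝ) : ℂ) = star w ⬝ᵥ w := by
    intro w
    simp only [dotProduct, Pi.star_apply, RCLike.star_def, Complex.conj_mul']
    push_cast; rfl
  apply Complex.ofReal_injective
  rw [Complex.ofReal_mul, key, key, star_mulVec, hAH, ← dotProduct_mulVec, mulVec_mulVec, hAA,
    smul_mulVec, one_mulVec, dotProduct_smul, smul_eq_mul]

theorem sum_sq_norm_mulVec_combination_le {ι : Type*} [Fintype ι] [DecidableEq ι] {N : ℕ}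
    {U : ℕ → Matrix ι ι ℂ} (h1 : ∀ i, (U i)ᴴ = U i)
    (h3 : ∀ i < N, ∀ j < N, U i * U j + U j * U i = if i = j then 2 else 0) (c : ℕ → ℂ) (y : ι → ℂ) :
    ∑ a, ‖((∑ k ∈ range N, c k • U k) *ᵥ y) a‖ ^ 2
      ≤ 2 * (∑ k ∈ range N, ‖c k‖ ^ 2) * ∑ a, ‖y a‖ ^ 2 := by
  have hr := sum_sq_norm_mulVec_real_combination h1 h3 (fun k => (c k).re) y
  have hi := sum_sq_norm_mulVec_real_combination h1 h3 (fun k => (c k).im) y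
  have e : ∀ a, ((∑ k ∈ range N, c k • U k) *ᵥ y) a
      = ((∑ k ∈ range N, ((c k).re : ℂ) • U k) *ᵥ y) a
        + Complex.I * ((∑ k ∈ range N, ((c k).im : ℂ) • U k) *ᵥ y) a := by
    intro a
    have : ∑ k ∈ range N, c k • U k = ∑ k ∈ range N, ((c k).re : ℂ) • U k
        + Complex.I • ∑ k ∈ range N, ((c k).im : ℂ) • U k := by
      rw [smul_sum, ← sum_add_distrib]
      refine sum_congr rfl fun k _ => ?_
      rw [smul_smul, ← add_smul]
      congr 1
      rw [mul_comm, Complex.re_add_im]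
    rw [this, add_mulVec, smul_mulVec]
    rfl
  have e2 : ∑ k ∈ range N, ‖c k‖ ^ 2 = ∑ k ∈ range N, (c k).re ^ 2 + ∑ k ∈ range N, (c k).im ^ 2 := by
    rw [← sum_add_distrib]
    refine sum_congr rfl fun k _ => ?_
    rw [← Complex.normSq_eq_norm_sq, Complex.normSq_apply]; ring
  calc _ ≤ ∑ a, (2 * ‖((∑ k ∈ range N, ((c k).re : ℂ) • U k) *ᵥ y) a‖ ^ 2
        + 2 * ‖((∑ k ∈ range N, ((c k).im : ℂ) • U k) *ᵥ y) a‖ ^ 2) := by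
        refine sum_le_sum fun a _ => ?_
        rw [e]
        refine (norm_add_sq_le_two _ _).trans_eq ?_
        rw [norm_mul, Complex.norm_I, one_mul]
    _ = _ := by
        rw [sum_add_distrib, ← mul_sum, ← mul_sum, hr, hi, e2]; ring

theorem sq_norm_dotProduct_le {ι : Type*} [Fintype ι] (x y : ι → ℂ) :
    ‖x ⬝ᵥ y‖ ^ 2 ≤ (∑ a, ‖x a‖ ^ 2) * ∑ a, ‖y a‖ ^ 2 := by
  have h : ‖x ⬝ᵥ y‖ ≤ ∑ a, ‖x a‖ * ‖y a‖ := by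
    refine (norm_sum_le _ _).trans_eq ?_
    simp_rw [norm_mul]
  calc _ ≤ (∑ a, ‖x a‖ * ‖y a‖) ^ 2 := by gcongr
    _ ≤ _ := sum_mul_sq_le_sq_mul_sq _ _ _

/-- Square-zero matrices spanning a space that is Hilbertian up to the constant `√2`. -/
structure IsNilpotentSpinFamily {ι : Type*} [Fintype ι] (N : ℕ) (W : ℕ → Matrix ι ι ℂ) : Prop where
  rowBounded : IsRowBounded N W
  mul_eq_zero : ∀ i j, W i * W j = 0
  trace_eq_zero : ∀ i, (W i).trace = 0
  sum_sq : ∀ i < N, ∑ a, ∑ b, W i a b * W i a b = Fintype.card ι / 2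

theorem IsNilpotentSpinFamily.reindex {ι κ : Type*} [Fintype ι] [Fintype κ] {N : ℕ}
    {W : ℕ → Matrix ι ι ℂ} (h : IsNilpotentSpinFamily N W) (e : ι ≃ κ) :
    IsNilpotentSpinFamily N fun i => Matrix.reindex e e (W i) where
  rowBounded c x y := by
    have := h.rowBounded c (fun a => x (e a)) (fun b => y (e b))
    rw [Equiv.sum_comp e fun a => ‖x a‖ ^ 2, Equiv.sum_comp e fun a => ‖y a‖ ^ 2] at this
    convert this using 6 with k
    rw [← Equiv.sum_comp e]
    refine sum_congr rfl fun a _ => ?_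
    rw [← Equiv.sum_comp e]
    simp
  mul_eq_zero i j := by
    simp [reindex_apply, submatrix_mul_equiv, h.mul_eq_zero]
  trace_eq_zero i := by
    rw [← h.trace_eq_zero i, trace, trace, ← Equiv.sum_comp e]
    simp
  sum_sq i hi := by
    rw [← Fintype.card_congr e, ← h.sum_sq i hi, ← Equiv.sum_comp e]
    refine sum_congr rfl fun a _ => ?_
    rw [← Equiv.sum_comp e]
    simp

theorem exists_isNilpotentSpinFamily (N : ℕ) :
    ∃ (m : ℕ) (_ : 1 ≤ m) (W : ℕ → Matrix (Fin m) (Fin m) ℂ), IsNilpotentSpinFamily N W := by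
  obtain ⟨ι, _, _, _, U, h1, h2, h3⟩ := exists_anticommuting_family N
  suffices h : IsNilpotentSpinFamily N (ι := ι ⊕ ι) fun i => fromBlocks 0 (U i) 0 0 from
    ⟨Fintype.card (ι ⊕ ι), Fintype.card_pos, _, h.reindex (Fintype.equivFin _)⟩
  refine ⟨fun c x y => ?_, fun i j => by simp [fromBlocks_multiply], fun i => by simp [trace], fun i hi => ?_⟩
  · have e : ∑ k ∈ range N, c k * ∑ a, ∑ b, (fromBlocks 0 (U k) 0 0 : Matrix (ι ⊕ ι) (ι ⊕ ι) ℂ) a b * (x a * y b)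
        = (fun a => x (Sum.inl a)) ⬝ᵥ ((∑ k ∈ range N, c k • U k) *ᵥ fun b => y (Sum.inr b)) := by
      simp only [Fintype.sum_sum_type, fromBlocks_apply₁₁, fromBlocks_apply₁₂, fromBlocks_apply₂₁,
        fromBlocks_apply₂₂, Matrix.zero_apply, zero_mul, sum_const_zero, zero_add, add_zero]
      rw [sum_mulVec, dotProduct_sum]
      refine sum_congr rfl fun k _ => ?_
      simp only [dotProduct, mulVec, mul_sum, Matrix.smul_apply, smul_eq_mul]
      refine sum_congr rfl fun a _ => sum_congr rfl fun b _ => ?_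
      ring
    rw [e]
    have hx : ∑ a, ‖x (Sum.inl a)‖ ^ 2 ≤ ∑ a, ‖x a‖ ^ 2 := by
      rw [Fintype.sum_sum_type (f := fun a => ‖x a‖ ^ 2)]
      exact le_add_of_nonneg_right (sum_nonneg fun _ _ => by positivity)
    have hy : ∑ a, ‖y (Sum.inr a)‖ ^ 2 ≤ ∑ a, ‖y a‖ ^ 2 := by
      rw [Fintype.sum_sum_type (f := fun a => ‖y a‖ ^ 2)]
      exact le_add_of_nonneg_left (sum_nonneg fun _ _ => by positivity)
    calc _ ≤ _ := sq_norm_dotProduct_le _ _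
      _ ≤ (∑ a, ‖x a‖ ^ 2) * (2 * (∑ k ∈ range N, ‖c k‖ ^ 2) * ∑ a, ‖y a‖ ^ 2) := by
          refine mul_le_mul hx ((sum_sq_norm_mulVec_combination_le h1 h3 c _).trans ?_)
            (sum_nonneg fun _ _ => by positivity) (sum_nonneg fun _ _ => by positivity)
          exact mul_le_mul_of_nonneg_left hy (by positivity)
      _ = _ := by ring
  · simp only [Fintype.sum_sum_type, fromBlocks_apply₁₁, fromBlocks_apply₁₂, fromBlocks_apply₂₁,
        fromBlocks_apply₂₂, Matrix.zero_apply, zero_mul, sum_const_zero, zero_add, add_zero]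
    have h4 : U i * U i = 1 := by
      have := h3 i hi i hi
      rw [if_pos rfl, ← two_mul] at this
      have h5 : (2 : ℂ) • (U i * U i) = (2 : ℂ) • (1 : Matrix ι ι ℂ) := by
        rw [two_smul, two_smul, one_add_one_eq_two, ← two_mul, this]
      exact smul_right_injective _ two_ne_zero h5
    have h6 : ∑ a, ∑ b, U i a b * U i a b = (U i * U i).trace := by
      refine sum_congr rfl fun a _ => ?_
      rw [diag_apply, mul_apply]
      refine sum_congr rfl fun b _ => ?_
      nth_rw 2 [← h2 i]; rfl
    rw [h6, h4, trace_one, Fintype.card_sum]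
    push_cast; ring

/-- The polynomials whose coefficients are the entries of a vector indexed by degree. -/
noncomputable def coordPolynomial {ι : Type*} {n : ℕ} :
    EuclideanSpace ℂ (Fin (n + 1) × ι) →ₗ[ℂ] ι → ℂ[X] where
  toFun x a := ∑ i : Fin (n + 1), monomial i (x (i, a))
  map_add' x y := by ext a; simp [sum_add_distrib]
  map_smul' c x := by ext a : 1; simp [smul_sum, smul_monomial]

theorem coeff_coordPolynomial {ι : Type*} {n : ℕ} (x : EuclideanSpace ℂ (Fin (n + 1) × ι)) (a : ι)
    (i : Fin (n + 1)) : (coordPolynomial x a).coeff i = x (i, a) := by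
  simp [coordPolynomial, coeff_monomial, Fin.val_inj]

theorem natDegree_coordPolynomial_lt {ι : Type*} {n : ℕ} (x : EuclideanSpace ℂ (Fin (n + 1) × ι)) (a : ι) :
    (coordPolynomial x a).natDegree < n + 1 := by
  refine Nat.lt_succ_of_le (natDegree_le_iff_coeff_eq_zero.2 fun k hk => ?_)
  simp only [coordPolynomial, LinearMap.coe_mk, AddHom.coe_mk, finsetSum_coeff]
  exact sum_eq_zero fun i _ => coeff_monomial_of_ne _ (by omega)

theorem sum_sq_norm_coeff_coordPolynomial {ι : Type*} [Fintype ι] {n : ℕ}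
    (x : EuclideanSpace ℂ (Fin (n + 1) × ι)) :
    ∑ a, ∑ i ∈ range (n + 1), ‖(coordPolynomial x a).coeff i‖ ^ 2 = ‖x‖ ^ 2 := by
  rw [EuclideanSpace.norm_sq_eq, Fintype.sum_prod_type_right]
  refine sum_congr rfl fun a _ => ?_
  rw [sum_range]
  simp_rw [coeff_coordPolynomial]

/-- Polynomial matrices act on vectors of truncated power series. -/
noncomputable def truncatedAction {ι : Type*} [Fintype ι] [DecidableEq ι] (n : ℕ) :
    Matrix ι ι ℂ[X] →ₐ[ℂ] Module.End ℂ (EuclideanSpace ℂ (Fin (n + 1) × ι)) :=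
  AlgHom.ofLinearMap
    { toFun := fun Q =>
        { toFun := fun x => WithLp.toLp 2 fun p => ((Q *ᵥ coordPolynomial x) p.2).coeff p.1
          map_add' := fun x y => by ext p; simp [mulVec_add]
          map_smul' := fun c x => by ext p; simp [mulVec_smul] }
      map_add' := fun P Q => by ext x p; simp [add_mulVec]
      map_smul' := fun c Q => by ext x p; simp [smul_mulVec] }
    (by
      ext x p
      simp [coeff_coordPolynomial])
    (fun P Q => by
      ext x p
      change (((P * Q) *ᵥ coordPolynomial x) p.2).coeff p.1
        = ((P *ᵥ coordPolynomial (WithLp.toLp 2 fun p : Fin (n + 1) × ι =>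
            ((Q *ᵥ coordPolynomial x) p.2).coeff p.1)) p.2).coeff p.1
      rw [← mulVec_mulVec]
      generalize hq : Q *ᵥ coordPolynomial x = q
      simp only [mulVec, dotProduct, finsetSum_coeff]
      refine sum_congr rfl fun b _ => ?_
      refine coeff_mul_eq_of_coeff_eq _ (n := n + 1) (fun l hl => ?_) p.1.2
      exact (coeff_coordPolynomial (WithLp.toLp 2 fun p : Fin (n + 1) × ι =>
        (q p.2).coeff p.1) b ⟨l, hl⟩).symm)

theorem truncatedAction_apply {ι : Type*} [Fintype ι] [DecidableEq ι] {n : ℕ} (Q : Matrix ι ι ℂ[X])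
    (x : EuclideanSpace ℂ (Fin (n + 1) × ι)) (p : Fin (n + 1) × ι) :
    truncatedAction n Q x p = ((Q *ᵥ coordPolynomial x) p.2).coeff p.1 := rfl

theorem aeval_X_smul_one_add {ι : Type*} [Fintype ι] [DecidableEq ι] {G : Matrix ι ι ℂ[X]}
    (hG : G * G = 0) (p : ℂ[X]) :
    aeval ((X : ℂ[X]) • (1 : Matrix ι ι ℂ[X]) + G) p
      = p • (1 : Matrix ι ι ℂ[X]) + derivative p • G := by
  induction p using Polynomial.induction_on' with
  | add p q hp hq => rw [map_add, hp, hq, derivative_add, add_smul, add_smul]; abel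
  | monomial k c =>
    have h : ∀ k, ((X : ℂ[X]) • (1 : Matrix ι ι ℂ[X]) + G) ^ k
        = (X ^ k : ℂ[X]) • (1 : Matrix ι ι ℂ[X]) + (derivative (X ^ k) : ℂ[X]) • G := by
      intro k
      induction k with
      | zero => simp
      | succ k ih =>
        rw [pow_succ, ih, pow_succ (X : ℂ[X]), derivative_mul, derivative_X, mul_one]
        have e : ∀ a b : ℂ[X], (a • (1 : Matrix ι ι ℂ[X]) + b • G) * (X • (1 : Matrix ι ι ℂ[X]) + G)
            = (a * X) • (1 : Matrix ι ι ℂ[X]) + (b * X + a) • G := fun a b => by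
          rw [add_mul, mul_add, mul_add, smul_mul_smul_comm, smul_mul_smul_comm, smul_mul_assoc,
            smul_mul_assoc, hG, mul_one, mul_one, one_mul, smul_zero, add_zero, add_smul]
          abel
        exact e _ _
    rw [← C_mul_X_pow_eq_monomial, map_mul, aeval_C, map_pow, aeval_X, h, derivative_C_mul,
      mul_smul, mul_smul, ← smul_add, Algebra.algebraMap_eq_smul_one, smul_mul_assoc, one_mul]
    ext a b : 2
    simp [mul_add]

/-- A square-zero Hankel-type perturbation built from a family of matrices. -/
noncomputable def spinPolynomial {ι : Type*} (n : ℕ) (g : ℕ → ℝ) (W : ℕ → Matrix ι ι ℂ) :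
    Matrix ι ι ℂ[X] :=
  Matrix.of fun a b => ∑ k ∈ range (n + 1), monomial (n - k) ((g k : ℂ) * W k a b)

theorem spinPolynomial_mul_self {ι : Type*} [Fintype ι] (n : ℕ) (g : ℕ → ℝ) {W : ℕ → Matrix ι ι ℂ}
    (hW : ∀ i j, W i * W j = 0) : spinPolynomial n g W * spinPolynomial n g W = 0 := by
  ext a b : 1
  simp only [mul_apply, spinPolynomial, of_apply, sum_mul_sum, monomial_mul_monomial, Matrix.zero_apply]
  rw [Finset.sum_comm]
  refine Finset.sum_eq_zero (fun i _ => ?_)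
  rw [Finset.sum_comm]
  refine sum_eq_zero fun j _ => ?_
  rw [← map_sum (monomial (n - i + (n - j)))]
  have := congrFun (congrFun (hW i j) a) b
  rw [mul_apply, Matrix.zero_apply] at this
  have e : ∑ x, (g i : ℂ) * W i a x * ((g j : ℂ) * W j x b) = (g i : ℂ) * g j * ∑ x, W i a x * W j x b := by
    rw [mul_sum]; exact sum_congr rfl fun _ _ => by ring
  rw [e, this, mul_zero, map_zero]

/-- Conjugation combined with reversal of the degrees. -/
noncomputable def conjReverse {ι : Type*} {n : ℕ} (x : EuclideanSpace ℂ (Fin (n + 1) × ι)) :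
    EuclideanSpace ℂ (Fin (n + 1) × ι) :=
  WithLp.toLp 2 fun p => starRingEnd ℂ (x (Fin.rev p.1, p.2))

theorem norm_conjReverse {ι : Type*} [Fintype ι] {n : ℕ} (x : EuclideanSpace ℂ (Fin (n + 1) × ι)) :
    ‖conjReverse x‖ = ‖x‖ := by
  rw [EuclideanSpace.norm_eq, EuclideanSpace.norm_eq]
  congr 1
  simp only [conjReverse, RCLike.norm_conj, Fintype.sum_prod_type]
  exact Equiv.sum_comp Fin.revPerm fun i => ∑ a, ‖x (i, a)‖ ^ 2

theorem coeff_coordPolynomial_conjReverse_mul {ι : Type*} {n : ℕ}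
    (x : EuclideanSpace ℂ (Fin (n + 1) × ι)) (a : ι) (Q : ℂ[X]) :
    (coordPolynomial (conjReverse x) a * Q).coeff n
      = ∑ i : Fin (n + 1), starRingEnd ℂ (x (i, a)) * Q.coeff i := by
  rw [mul_comm, coeff_mul, Nat.sum_antidiagonal_eq_sum_range_succ_mk, sum_range]
  refine sum_congr rfl fun i _ => ?_
  have := coeff_coordPolynomial (conjReverse x) a (Fin.rev i)
  rw [Fin.val_rev, Nat.add_sub_add_right] at this
  dsimp only
  rw [this, conjReverse]
  simp [mul_comm]

theorem inner_truncatedAction_spinPolynomial {ι : Type*} [Fintype ι] [DecidableEq ι] {n : ℕ}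
    (g : ℕ → ℝ) (W : ℕ → Matrix ι ι ℂ) (q : ℂ[X]) (x y : EuclideanSpace ℂ (Fin (n + 1) × ι)) :
    inner ℂ x (truncatedAction n (q • spinPolynomial n g W) y)
      = ∑ k ∈ range (n + 1), (g k : ℂ) * ∑ a, ∑ b, W k a b *
        (q * (coordPolynomial (conjReverse x) a * coordPolynomial y b)).coeff k := by
  have h1 : inner ℂ x (truncatedAction n (q • spinPolynomial n g W) y)
      = ∑ a, (coordPolynomial (conjReverse x) a *
          ((q • spinPolynomial n g W) *ᵥ coordPolynomial y) a).coeff n := by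
    simp_rw [coeff_coordPolynomial_conjReverse_mul]
    rw [PiLp.inner_apply, Fintype.sum_prod_type_right]
    refine sum_congr rfl fun a _ => sum_congr rfl fun i _ => ?_
    rw [truncatedAction_apply, RCLike.inner_apply, mul_comm]
  rw [h1]
  simp_rw [mul_sum]
  rw [sum_comm]
  refine sum_congr rfl fun a _ => ?_
  rw [sum_comm]
  simp only [mulVec, dotProduct, mul_sum, finsetSum_coeff]
  refine sum_congr rfl fun b _ => ?_
  simp only [Matrix.smul_apply, smul_eq_mul, spinPolynomial, of_apply, mul_sum, sum_mul, finsetSum_coeff]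
  refine sum_congr rfl fun k hk => ?_
  have hk : k ≤ n := Nat.lt_succ_iff.1 (mem_range.1 hk)
  have e : coordPolynomial (conjReverse x) a * (q * monomial (n - k) ((g k : ℂ) * W k a b) * coordPolynomial y b)
      = C ((g k : ℂ) * W k a b) * ((q * (coordPolynomial (conjReverse x) a * coordPolynomial y b)) * X ^ (n - k)) := by
    rw [← C_mul_X_pow_eq_monomial]; ring
  rw [e, coeff_C_mul]
  have := coeff_mul_X_pow (q * (coordPolynomial (conjReverse x) a * coordPolynomial y b)) (n - k) k
  rw [Nat.add_sub_of_le hk] at this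
  rw [this, mul_assoc]

theorem norm_truncatedAction_smul_one_le {ι : Type*} [Fintype ι] [DecidableEq ι] {n : ℕ}
    {f : ℂ[X]} {M : ℝ} (hM : 0 < M) (hf : ∀ z : ℂ, ‖z‖ ≤ 1 → ‖f.eval z‖ ≤ M)
    (y : EuclideanSpace ℂ (Fin (n + 1) × ι)) :
    ‖truncatedAction n (f • (1 : Matrix ι ι ℂ[X])) y‖ ≤ M * ‖y‖ := by
  refine abs_le_of_sq_le_sq' ?_ (by positivity) |>.2
  rw [mul_pow, EuclideanSpace.norm_sq_eq, Fintype.sum_prod_type_right,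
    ← sum_sq_norm_coeff_coordPolynomial y, mul_sum]
  refine sum_le_sum fun a _ => ?_
  refine le_of_eq_of_le ?_ (sum_sq_norm_coeff_mul_le hf (coordPolynomial y a) (n + 1))
  rw [sum_range]
  refine sum_congr rfl fun i _ => ?_
  rw [truncatedAction_apply, smul_mulVec, one_mulVec, Pi.smul_apply, smul_eq_mul]

theorem norm_apply_le_of_norm_inner_le {E : Type*} [NormedAddCommGroup E] [InnerProductSpace ℂ E]
    {A : E →ₗ[ℂ] E} {K : ℝ} (hK : 0 ≤ K) (h : ∀ x y, ‖inner ℂ x (A y)‖ ≤ K * (‖x‖ ^ 2 + ‖y‖ ^ 2))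
    (y : E) : ‖A y‖ ≤ 2 * K * ‖y‖ := by
  rcases eq_or_ne (A y) 0 with hA | hA
  · rw [hA, norm_zero]; positivity
  · have hy : y ≠ 0 := by rintro rfl; exact hA (map_zero A)
    have hA' := norm_pos_iff.2 hA
    have hy' := norm_pos_iff.2 hy
    have := h (((‖y‖ / ‖A y‖ : ℝ) : ℂ) • A y) y
    have e1 : ‖inner ℂ (((‖y‖ / ‖A y‖ : ℝ) : ℂ) • A y) (A y)‖ = ‖y‖ * ‖A y‖ := by
      rw [inner_smul_left, inner_self_eq_norm_sq_to_K, norm_mul, RCLike.norm_conj, norm_pow,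
        Complex.norm_real, Real.norm_of_nonneg (by positivity)]
      simp only [Complex.coe_algebraMap, Complex.norm_real, norm_norm]
      field_simp
    have e2 : ‖((‖y‖ / ‖A y‖ : ℝ) : ℂ) • A y‖ = ‖y‖ := by
      rw [norm_smul, Complex.norm_real, Real.norm_of_nonneg (by positivity)]
      field_simp
    rw [e1, e2] at this
    refine le_of_mul_le_mul_left ?_ hy'
    linarith

theorem norm_toEuclideanCLM_le_one {ι : Type*} [Fintype ι] [DecidableEq ι] {M : Matrix ι ι ℂ}
    (h : ∀ x y : ι → ℂ, ‖∑ a, ∑ b, M a b * (x a * y b)‖ ^ 2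
      ≤ (∑ a, ‖x a‖ ^ 2) * (∑ b, ‖y b‖ ^ 2)) :
    ‖Matrix.toEuclideanCLM (𝕜 := ℂ) M‖ ≤ 1 := by
  refine ContinuousLinearMap.opNorm_le_bound _ zero_le_one fun y => ?_
  rw [one_mul]
  have := h (fun a => starRingEnd ℂ ((M *ᵥ y.ofLp) a)) y.ofLp
  simp only [RCLike.norm_conj] at this
  have hy : ‖y‖ ^ 2 = ∑ b, ‖y.ofLp b‖ ^ 2 := EuclideanSpace.norm_sq_eq y
  have hM : ‖Matrix.toEuclideanCLM (𝕜 := ℂ) M y‖ ^ 2 = ∑ a, ‖(M *ᵥ y.ofLp) a‖ ^ 2 :=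
    EuclideanSpace.norm_sq_eq _
  have e : ∑ a, ∑ b, M a b * (starRingEnd ℂ ((M *ᵥ y.ofLp) a) * y.ofLp b)
      = ((∑ a, ‖(M *ᵥ y.ofLp) a‖ ^ 2 : ℝ) : ℂ) := by
    push_cast
    refine sum_congr rfl fun a _ => ?_
    rw [← Complex.conj_mul']
    conv_rhs => rw [mulVec, dotProduct, mul_sum]
    exact sum_congr rfl fun b _ => by rw [mulVec, dotProduct]; ring
  rw [e, Complex.norm_real, ← hM, ← hy, Real.norm_of_nonneg (sq_nonneg _)] at this
  rcases (norm_nonneg (Matrix.toEuclideanCLM (𝕜 := ℂ) M y)).eq_or_lt with h0 | h0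
  · rw [← h0]; exact norm_nonneg _
  · refine abs_le_of_sq_le_sq' ?_ (norm_nonneg _) |>.2
    refine le_of_mul_le_mul_left ?_ (pow_pos h0 2)
    rwa [← sq]

theorem norm_le_mul_iSup_of_forall_bound {p : ℂ[X]} {K t : ℝ} (hK : 0 < K)
    (h : ∀ M : ℝ, 0 < M → (∀ z : ℂ, ‖z‖ ≤ 1 → ‖p.eval z‖ ≤ M) → t ≤ K * M) :
    t ≤ K * ⨆ z : Metric.closedBall (0 : ℂ) 1, ‖p.eval (z : ℂ)‖ := by
  have hb : BddAbove (Set.range fun z : Metric.closedBall (0 : ℂ) 1 => ‖p.eval (z : ℂ)‖) :=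
    (isCompact_range (p.continuous.norm.comp continuous_subtype_val)).bddAbove
  have h0 : 0 ≤ ⨆ z : Metric.closedBall (0 : ℂ) 1, ‖p.eval (z : ℂ)‖ :=
    Real.iSup_nonneg fun _ => norm_nonneg _
  refine le_of_forall_pos_le_add fun ε hε => ?_
  have := h ((⨆ z : Metric.closedBall (0 : ℂ) 1, ‖p.eval (z : ℂ)‖) + ε / K) (by positivity)
    fun z hz => (le_ciSup hb ⟨z, mem_closedBall_zero_iff.2 hz⟩).trans
      (le_add_of_nonneg_right (by positivity))
  refine this.trans_eq ?_
  field_simp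

/-- The weights of the Hankel perturbation. -/
noncomputable def hankelWeight (k : ℕ) : ℝ := 1 / (((k : ℝ) + 1) * √((k : ℝ) + 1))

theorem hankelWeight_sq (k : ℕ) : hankelWeight k ^ 2 = 1 / ((k : ℝ) + 1) ^ 3 := by
  rw [hankelWeight, div_pow, mul_pow, Real.sq_sqrt (by positivity)]
  ring

/-- The action on truncated power series, by bounded operators. -/
noncomputable def truncatedContinuousAction {ι : Type*} [Fintype ι] [DecidableEq ι] (n : ℕ) :
    Matrix ι ι ℂ[X] →ₐ[ℂ]
      EuclideanSpace ℂ (Fin (n + 1) × ι) →L[ℂ] EuclideanSpace ℂ (Fin (n + 1) × ι) :=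
  (Module.End.toContinuousLinearMap (EuclideanSpace ℂ (Fin (n + 1) × ι))).toAlgHom.comp
    (truncatedAction n)

/-- Multiplication by the variable on truncated power series, perturbed by a Hankel block. -/
noncomputable def truncatedFoguelHankel {ι : Type*} [Fintype ι] [DecidableEq ι] (n : ℕ)
    (W : ℕ → Matrix ι ι ℂ) :
    EuclideanSpace ℂ (Fin (n + 1) × ι) →L[ℂ] EuclideanSpace ℂ (Fin (n + 1) × ι) :=
  truncatedContinuousAction n ((X : ℂ[X]) • (1 : Matrix ι ι ℂ[X]) + spinPolynomial n hankelWeight W)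

theorem aeval_truncatedFoguelHankel {ι : Type*} [Fintype ι] [DecidableEq ι] {n N : ℕ}
    {W : ℕ → Matrix ι ι ℂ} (hW : IsNilpotentSpinFamily N W) (p : ℂ[X])
    (x : EuclideanSpace ℂ (Fin (n + 1) × ι)) :
    aeval (truncatedFoguelHankel n W) p x = truncatedAction n (p • (1 : Matrix ι ι ℂ[X])) x
      + truncatedAction n (derivative p • spinPolynomial n hankelWeight W) x := by
  have h1 := DFunLike.congr_fun (aeval_algHom (truncatedContinuousAction n)
    ((X : ℂ[X]) • (1 : Matrix ι ι ℂ[X]) + spinPolynomial n hankelWeight W)) p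
  rw [AlgHom.comp_apply, aeval_X_smul_one_add (spinPolynomial_mul_self n _ hW.mul_eq_zero)]
    at h1
  rw [truncatedFoguelHankel, h1, map_add]
  rfl

theorem norm_aeval_truncatedFoguelHankel_le {ι : Type*} [Fintype ι] [DecidableEq ι] {n : ℕ}
    {W : ℕ → Matrix ι ι ℂ} (hW : IsNilpotentSpinFamily (n + 1) W) (p : ℂ[X]) :
    ‖aeval (truncatedFoguelHankel n W) p‖
      ≤ 35 * ⨆ z : Metric.closedBall (0 : ℂ) 1, ‖p.eval (z : ℂ)‖ := by
  obtain ⟨μ, hμ⟩ := exists_measure_integral_pow_mul_conj_pow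
  have hμ : HasWeightedBergmanMoments μ := hμ
  refine norm_le_mul_iSup_of_forall_bound (by norm_num) fun M hM hp => ?_
  refine ContinuousLinearMap.opNorm_le_bound _ (by positivity) fun y => ?_
  rw [aeval_truncatedFoguelHankel hW]
  have h1 := norm_truncatedAction_smul_one_le (ι := ι) (n := n) hM hp y
  have h2 : ‖truncatedAction n (derivative p • spinPolynomial n hankelWeight W) y‖
      ≤ 2 * (17 * M) * ‖y‖ := by
    refine norm_apply_le_of_norm_inner_le (by positivity) (fun x y => ?_) y
    rw [inner_truncatedAction_spinPolynomial]
    refine (hμ.norm_sum_coeff_derivative_mul_le hW.rowBounded hankelWeight_sq hM hp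
      (fun a => natDegree_coordPolynomial_lt _ a)
      (fun a => natDegree_coordPolynomial_lt _ a)).trans_eq ?_
    rw [sum_sq_norm_coeff_coordPolynomial, sum_sq_norm_coeff_coordPolynomial, norm_conjReverse]
  refine (norm_add_le _ _).trans ?_
  linarith

theorem truncatedFoguelHankel_pow_single {ι : Type*} [Fintype ι] [DecidableEq ι] {n N : ℕ}
    {W : ℕ → Matrix ι ι ℂ} (hW : IsNilpotentSpinFamily N W) {k : ℕ} (hk : k ≤ n) (r s : ι) :
    (truncatedFoguelHankel n W ^ (k + 1)) (EuclideanSpace.single (0, s) 1) (Fin.last n, r)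
      = (if k + 1 = n then (1 : Matrix ι ι ℂ) r s else 0)
        + ((k : ℂ) + 1) * hankelWeight k * W k r s := by
  have e : coordPolynomial (n := n) (EuclideanSpace.single (0, s) (1 : ℂ)) = Pi.single s 1 := by
    funext a
    rw [coordPolynomial]
    simp only [LinearMap.coe_mk, AddHom.coe_mk]
    rw [sum_eq_single 0]
    · rcases eq_or_ne a s with rfl | h
      · simp
      · simp [h]
    · intro i _ hi; simp [hi]
    · simp
  have h := aeval_truncatedFoguelHankel (n := n) hW (X ^ (k + 1))
    (EuclideanSpace.single (0, s) 1)
  rw [map_pow, aeval_X] at h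
  rw [h, PiLp.add_apply, truncatedAction_apply, truncatedAction_apply, e, mulVec_single_one,
    mulVec_single_one]
  simp only [Matrix.col_apply, Matrix.smul_apply, smul_eq_mul, Fin.val_last, spinPolynomial, of_apply]
  congr 1
  · rcases eq_or_ne r s with rfl | h
    · simp [coeff_X_pow, eq_comm]
    · simp [h]
  · rw [derivative_X_pow, Nat.add_sub_cancel, mul_sum, finsetSum_coeff,
      sum_eq_single_of_mem k (mem_range.2 (Nat.lt_succ_of_le hk))]
    · rw [mul_assoc, coeff_C_mul, X_pow_mul_monomial, show n - k + k = n by omega, coeff_monomial_same]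
      push_cast
      ring
    · intro i hi hik
      rw [mul_assoc, coeff_C_mul, X_pow_mul_monomial, coeff_monomial_of_ne, mul_zero]
      have := mem_range.1 hi
      omega

/-- The normalized coefficients of the test polynomials. -/
noncomputable def testCoefficient (N k : ℕ) : ℝ :=
  1 / √(2 * (∑ i ∈ range N, 1 / ((i : ℝ) + 1)) * ((k : ℝ) + 1))

theorem sum_range_one_div_pos (n : ℕ) : 0 < ∑ i ∈ range (n + 1), 1 / ((i : ℝ) + 1) :=
  sum_pos (fun i _ => by positivity) (by simp)

theorem sum_testCoefficient_sq (n : ℕ) :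
    2 * ∑ k ∈ range (n + 1), testCoefficient (n + 1) k ^ 2 = 1 := by
  have h := sum_range_one_div_pos n
  set H := ∑ i ∈ range (n + 1), 1 / ((i : ℝ) + 1) with hH
  have e : ∀ k, testCoefficient (n + 1) k ^ 2 = 1 / (2 * H) * (1 / ((k : ℝ) + 1)) := fun k => by
    rw [testCoefficient, ← hH, div_pow, Real.sq_sqrt (by positivity)]
    field_simp
  simp_rw [e]
  rw [← mul_sum, ← hH]
  field_simp

theorem sum_testCoefficient_mul_hankelWeight (n : ℕ) :
    ∑ k ∈ range (n + 1), testCoefficient (n + 1) k * (((k : ℝ) + 1) * hankelWeight k)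
      = √((∑ i ∈ range (n + 1), 1 / ((i : ℝ) + 1)) / 2) := by
  have h := sum_range_one_div_pos n
  set H := ∑ i ∈ range (n + 1), 1 / ((i : ℝ) + 1) with hH
  have e : ∀ k : ℕ, testCoefficient (n + 1) k * (((k : ℝ) + 1) * hankelWeight k)
      = 1 / √(2 * H) * (1 / ((k : ℝ) + 1)) := fun k => by
    rw [testCoefficient, ← hH, hankelWeight, Real.sqrt_mul (by positivity)]
    have : √((k : ℝ) + 1) * √((k : ℝ) + 1) = (k : ℝ) + 1 := Real.mul_self_sqrt (by positivity)
    have h0 : 0 < √((k : ℝ) + 1) := by positivity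
    field_simp
    rw [sq, this]
  simp_rw [e]
  rw [← mul_sum, ← hH]
  symm
  rw [Real.sqrt_eq_iff_mul_self_eq (by positivity) (by positivity)]
  have : √(2 * H) * √(2 * H) = 2 * H := Real.mul_self_sqrt (by positivity)
  rw [div_mul_eq_mul_div, one_mul, div_mul_div_comm, this]
  field_simp

/-- The coefficients of the test polynomials. -/
noncomputable def testMatrix {ι : Type*} (n : ℕ) (W : ℕ → Matrix ι ι ℂ) :
    Fin (n + 1 + 1) → Matrix ι ι ℂ :=
  Fin.cons 0 fun k => (testCoefficient (n + 1) k : ℂ) • W k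

theorem norm_sum_smul_testMatrix_le {ι : Type*} [Fintype ι] [DecidableEq ι] {n : ℕ}
    {W : ℕ → Matrix ι ι ℂ} (hW : IsNilpotentSpinFamily (n + 1) W) {z : ℂ} (hz : ‖z‖ ≤ 1) :
    ‖Matrix.toEuclideanCLM (𝕜 := ℂ) (∑ j : Fin (n + 1 + 1), (z ^ j.val) • testMatrix n W j)‖ ≤ 1 := by
  refine norm_toEuclideanCLM_le_one fun x y => ?_
  have h := hW.rowBounded (fun k => z ^ (k + 1) * testCoefficient (n + 1) k) x y
  have e : ∑ a, ∑ b, (∑ j : Fin (n + 1 + 1), (z ^ j.val) • testMatrix n W j) a b * (x a * y b)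
      = ∑ k ∈ range (n + 1), z ^ (k + 1) * testCoefficient (n + 1) k
        * ∑ a, ∑ b, W k a b * (x a * y b) := by
    rw [Fin.sum_univ_succ]
    simp only [testMatrix, Fin.cons_zero, smul_zero, zero_add, Fin.cons_succ, Fin.val_succ]
    rw [← sum_range (fun k => z ^ (k + 1) • (testCoefficient (n + 1) k : ℂ) • W k)]
    simp_rw [Matrix.sum_apply, Matrix.smul_apply, smul_eq_mul, sum_mul, mul_sum]
    symm
    rw [Finset.sum_comm]
    refine sum_congr rfl fun a _ => ?_
    rw [Finset.sum_comm]
    exact sum_congr rfl fun b _ => sum_congr rfl fun k _ => by ring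
  rw [e]
  refine h.trans ?_
  rw [mul_assoc]
  refine mul_le_of_le_one_left (by positivity) ?_
  rw [← sum_testCoefficient_sq n]
  refine mul_le_mul_of_nonneg_left (sum_le_sum fun k _ => ?_) zero_le_two
  rw [norm_mul, norm_pow, Complex.norm_real, Real.norm_eq_abs, ← sq_abs (testCoefficient _ _)]
  refine pow_le_pow_left₀ (by positivity) ?_ 2
  exact mul_le_of_le_one_left (abs_nonneg _) (pow_le_one₀ (norm_nonneg _) hz)

theorem sum_testMatrix_mul_pow {ι : Type*} [Fintype ι] [DecidableEq ι] {n : ℕ}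
    {W : ℕ → Matrix ι ι ℂ} (hW : IsNilpotentSpinFamily (n + 1) W) :
    ∑ r, ∑ s, ∑ j : Fin (n + 1 + 1), testMatrix n W j r s *
      (truncatedFoguelHankel n W ^ j.val) (EuclideanSpace.single (0, s) 1) (Fin.last n, r)
      = ((√((∑ i ∈ range (n + 1), 1 / ((i : ℝ) + 1)) / 2) * (Fintype.card ι / 2) : ℝ) : ℂ) := by
  have e : ∀ r s, ∑ j : Fin (n + 1 + 1), testMatrix n W j r s *
      (truncatedFoguelHankel n W ^ j.val) (EuclideanSpace.single (0, s) 1) (Fin.last n, r)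
      = ∑ k ∈ range (n + 1), ((if k + 1 = n then (testCoefficient (n + 1) k : ℂ) else 0)
          * (W k r s * (1 : Matrix ι ι ℂ) r s)
        + ((testCoefficient (n + 1) k * (((k : ℝ) + 1) * hankelWeight k) : ℝ) : ℂ)
          * (W k r s * W k r s)) := by
    intro r s
    rw [Fin.sum_univ_succ, sum_range]
    simp only [testMatrix, Fin.cons_zero, Matrix.zero_apply, zero_mul, zero_add, Fin.cons_succ,
      Fin.val_succ, Matrix.smul_apply, smul_eq_mul]
    refine sum_congr rfl fun k _ => ?_
    rw [truncatedFoguelHankel_pow_single hW (Nat.lt_succ_iff.1 k.2)]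
    push_cast
    split_ifs <;> ring
  simp_rw [e]
  have e2 : ∀ F : ι → ι → ℕ → ℂ, ∑ r, ∑ s, ∑ k ∈ range (n + 1), F r s k
      = ∑ k ∈ range (n + 1), ∑ r, ∑ s, F r s k := fun F => by
    symm
    rw [Finset.sum_comm]
    exact sum_congr rfl fun _ _ => Finset.sum_comm
  rw [e2, ← sum_testCoefficient_mul_hankelWeight, Complex.ofReal_mul, Complex.ofReal_sum, sum_mul]
  refine sum_congr rfl fun k hk => ?_
  simp_rw [sum_add_distrib, ← mul_sum]
  rw [hW.sum_sq k (mem_range.1 hk)]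
  have := hW.trace_eq_zero k
  rw [trace] at this
  simp only [diag_apply] at this
  simp [Matrix.one_apply, this]

theorem aeval_apply_of_intertwining {E F : Type*} [NormedAddCommGroup E] [NormedSpace ℂ E]
    [NormedAddCommGroup F] [NormedSpace ℂ F] {A : E →L[ℂ] E} {T : F →L[ℂ] F} {L : E →L[ℂ] F}
    (h : ∀ x, T (L x) = L (A x)) (p : ℂ[X]) (x : E) : aeval T p (L x) = L (aeval A p x) := by
  induction p using Polynomial.induction_on' with
  | add p q hp hq => simp [hp, hq]
  | monomial k c =>
    have hk : ∀ x, (T ^ k) (L x) = L ((A ^ k) x) := by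
      induction k with
      | zero => simp
      | succ k ih => intro x; rw [pow_succ, pow_succ, mul_apply_eq_comp, h, ih]; rfl
    rw [← smul_X_eq_monomial]
    simp [hk]

/-- The inclusion of a summand, as a linear isometry. -/
noncomputable def lpSingleIsometry {ι : Type*} [DecidableEq ι] (E : ι → Type*)
    [∀ i, NormedAddCommGroup (E i)] [∀ i, NormedSpace ℂ (E i)] (i : ι) : E i →ₗᵢ[ℂ] lp E 2 where
  toLinearMap := (lp.singleContinuousLinearMap ℂ E 2 i).toLinearMap
  norm_map' x := lp.norm_single (by norm_num) i x

theorem exists_directSum_operator {ι : Type*} [DecidableEq ι] {E : ι → Type*}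
    [∀ i, NormedAddCommGroup (E i)] [∀ i, NormedSpace ℂ (E i)] (A : ∀ i, E i →L[ℂ] E i)
    {S : ℂ[X] → ℝ} (hS : ∀ p, 0 ≤ S p) (hA : ∀ i p, ‖aeval (A i) p‖ ≤ S p) :
    ∃ T : lp E 2 →L[ℂ] lp E 2, (∀ p, ‖aeval T p‖ ≤ S p) ∧
      ∀ i x, T (lp.single 2 i x) = lp.single 2 i (A i x) := by
  have hX : ∀ i, ‖A i‖ ≤ S X := fun i => by simpa using hA i X
  refine ⟨lp.mapCLM 2 A (hS X) hX, fun p => ?_, fun i x => ?_⟩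
  · have : aeval (lp.mapCLM 2 A (hS X) hX) p = lp.mapCLM 2 (fun i => aeval (A i) p) (hS p)
        fun i => hA i p := by
      ext f i
      have := aeval_apply_of_intertwining (A := lp.mapCLM 2 A (hS X) hX) (T := A i)
        (L := lp.evalCLM ℂ E 2 i) (fun x => rfl) p f
      exact this.symm
    rw [this]
    exact lp.norm_mapCLM_le _ _ _ _
  · ext j
    rcases eq_or_ne j i with rfl | h
    · simp
    · simp [h]

theorem exists_linearIsometryEquiv_lp_nat (κ : ℕ → Type) [∀ n, Fintype (κ n)] [∀ n, Nonempty (κ n)] :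
    Nonempty (lp (fun n => EuclideanSpace ℂ (κ n)) 2 ≃ₗᵢ[ℂ] lp (fun _ : ℕ => ℂ) 2) := by
  classical
  have : Infinite (Σ n, κ n) := Infinite.of_surjective (Sigma.fst : (Σ n, κ n) → ℕ)
    fun n => ⟨⟨n, Classical.arbitrary _⟩, rfl⟩
  obtain ⟨e⟩ := nonempty_equiv_of_countable (α := ℕ) (β := Σ n, κ n)
  have key : ∀ (q : Σ n, κ n) (f : lp (fun n => EuclideanSpace ℂ (κ n)) 2),
      inner ℂ (lp.single (E := fun n => EuclideanSpace ℂ (κ n)) 2 q.1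
        (EuclideanSpace.single q.2 (1 : ℂ))) f = f q.1 q.2 := fun q f => by
    rw [lp.inner_single_left, EuclideanSpace.inner_single_left]
    simp
  let v : ℕ → lp (fun n => EuclideanSpace ℂ (κ n)) 2 := fun k =>
    lp.single 2 (e k).1 (EuclideanSpace.single (e k).2 (1 : ℂ))
  have hv : Orthonormal ℂ v := by
    rw [orthonormal_iff_ite]
    intro i j
    rw [key]
    rcases eq_or_ne i j with rfl | h
    · simp [v]
    · rw [if_neg h]
      have h' : e i ≠ e j := fun h' => h (e.injective h')
      simp only [v]
      generalize e i = a at h'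
      generalize e j = b at h'
      obtain ⟨a, a'⟩ := a
      obtain ⟨b, b'⟩ := b
      rcases eq_or_ne a b with rfl | hab
      · have : a' ≠ b' := by rintro rfl; exact h' rfl
        simp [this]
      · simp [hab]
  refine ⟨(HilbertBasis.mkOfOrthogonalEqBot hv ?_).repr⟩
  rw [eq_bot_iff]
  intro f hf
  rw [Submodule.mem_bot]
  ext n a
  have := (Submodule.mem_orthogonal _ _).1 hf (v (e.symm ⟨n, a⟩))
    (Submodule.subset_span ⟨_, rfl⟩)
  rw [show v (e.symm ⟨n, a⟩) = lp.single 2 (e (e.symm ⟨n, a⟩)).1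
    (EuclideanSpace.single (e (e.symm ⟨n, a⟩)).2 (1 : ℂ)) from rfl, key,
    Equiv.apply_symm_apply] at this
  simpa using this

/-- The operator on a finite Hilbert sum obtained by substituting `T` into a matrix polynomial. -/
noncomputable def blockOperator {H : Type*} [NormedAddCommGroup H] [InnerProductSpace ℂ H] {m d : ℕ}
    (D : Fin (d + 1) → Matrix (Fin m) (Fin m) ℂ) (T : H →L[ℂ] H) :
    PiLp 2 (fun _ : Fin m => H) →L[ℂ] PiLp 2 (fun _ : Fin m => H) :=
  (PiLp.continuousLinearEquiv 2 ℂ fun _ : Fin m => H).symm.toContinuousLinearMap.comp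
    (ContinuousLinearMap.pi fun r => ∑ s : Fin m, ∑ j : Fin (d + 1),
      D j r s • (T ^ j.val).comp (PiLp.proj 2 (fun _ : Fin m => H) s))

theorem blockOperator_apply {H : Type*} [NormedAddCommGroup H] [InnerProductSpace ℂ H] {m d : ℕ}
    (D : Fin (d + 1) → Matrix (Fin m) (Fin m) ℂ) (T : H →L[ℂ] H)
    (v : PiLp 2 (fun _ : Fin m => H)) (r : Fin m) :
    blockOperator D T v r = ∑ s : Fin m, ∑ j : Fin (d + 1), D j r s • (T ^ j.val) (v s) := by
  simp [blockOperator]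

theorem norm_sum_inner_le_norm_blockOperator {H : Type*} [NormedAddCommGroup H]
    [InnerProductSpace ℂ H] {m d : ℕ} (D : Fin (d + 1) → Matrix (Fin m) (Fin m) ℂ) (T : H →L[ℂ] H)
    {x y : Fin m → H} (hx : ∀ s, ‖x s‖ = 1) (hy : ∀ r, ‖y r‖ = 1) :
    ‖∑ r, ∑ s, ∑ j : Fin (d + 1), D j r s * inner ℂ (y r) ((T ^ j.val) (x s))‖
      ≤ ‖blockOperator D T‖ * m := by
  have hn : ∀ w : Fin m → H, (∀ s, ‖w s‖ = 1) →
      ‖(WithLp.toLp 2 w : PiLp 2 (fun _ : Fin m => H))‖ = √m := fun w hw => by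
    rw [PiLp.norm_eq_of_L2]; simp [hw]
  have h : ‖inner ℂ (WithLp.toLp 2 y : PiLp 2 (fun _ : Fin m => H))
      (blockOperator D T (WithLp.toLp 2 x))‖ ≤ ‖blockOperator D T‖ * m := by
    refine (norm_inner_le_norm _ _).trans ?_
    rw [hn y hy]
    have := (blockOperator D T).le_opNorm (WithLp.toLp 2 x)
    rw [hn x hx] at this
    refine (mul_le_mul_of_nonneg_left this (Real.sqrt_nonneg _)).trans_eq ?_
    rw [mul_left_comm, Real.mul_self_sqrt (Nat.cast_nonneg m)]
  refine le_of_eq_of_le ?_ h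
  rw [PiLp.inner_apply]
  simp [blockOperator_apply, inner_sum, inner_smul_right]

theorem exists_le_norm_blockOperator {H : Type*} [NormedAddCommGroup H] [InnerProductSpace ℂ H]
    {m n : ℕ} (hm : 1 ≤ m) {W : ℕ → Matrix (Fin m) (Fin m) ℂ} (hW : IsNilpotentSpinFamily (n + 1) W)
    {T : H →L[ℂ] H} (J : EuclideanSpace ℂ (Fin (n + 1) × Fin m) →ₗᵢ[ℂ] H)
    (hJ : ∀ x, T (J x) = J (truncatedFoguelHankel n W x)) :
    √((∑ i ∈ range (n + 1), 1 / ((i : ℝ) + 1)) / 2) / 2 ≤ ‖blockOperator (testMatrix n W) T‖ := by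
  have h := norm_sum_inner_le_norm_blockOperator (testMatrix n W) T
    (x := fun s => J (EuclideanSpace.single (0, s) 1))
    (y := fun r => J (EuclideanSpace.single (Fin.last n, r) 1)) (by simp) (by simp)
  have hT : ∀ (k : ℕ) x, (T ^ k) (J x) = J ((truncatedFoguelHankel n W ^ k) x) := fun k x => by
    have := aeval_apply_of_intertwining (L := J.toContinuousLinearMap) hJ (X ^ k) x
    simpa using this
  simp_rw [hT, LinearIsometry.inner_map_map, EuclideanSpace.inner_single_left, map_one, one_mul]
    at h
  rw [sum_testMatrix_mul_pow hW, Complex.norm_real, Real.norm_of_nonneg (by positivity),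
    Fintype.card_fin] at h
  have hm : (0 : ℝ) < m := by exact_mod_cast hm
  refine le_of_mul_le_mul_right ?_ hm
  linarith

theorem exists_lt_sqrt_sum_one_div (c : ℝ) :
    ∃ n : ℕ, c < √((∑ i ∈ range (n + 1), 1 / ((i : ℝ) + 1)) / 2) / 2 := by
  have h := (Real.tendsto_sum_range_one_div_nat_succ_atTop.comp
    (Filter.tendsto_add_atTop_nat 1)).eventually_gt_atTop (8 * c ^ 2)
  obtain ⟨n, hn⟩ := h.exists
  refine ⟨n, ?_⟩
  rw [lt_div_iff₀ two_pos]
  refine Real.lt_sqrt_of_sq_lt ?_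
  simp only [Function.comp_apply] at hn
  linarith

end

/-- Pisier. There is a bounded operator on `ℓ²(ℕ, ℂ)` that is polynomially
bounded but not completely polynomially bounded. -/
theorem exists_polynomiallyBounded_not_completelyPolynomiallyBounded :
    ∃ T : lp (fun _ : ℕ => ℂ) 2 →L[ℂ] lp (fun _ : ℕ => ℂ) 2,
      (∃ C > (0 : ℝ), ∀ p : Polynomial ℂ,
        ‖Polynomial.aeval T p‖ ≤ C * ⨆ z : Metric.closedBall (0 : ℂ) 1, ‖p.eval (z : ℂ)‖) ∧
      (∀ c > (0 : ℝ), ∃ (m : ℕ) (_ : 1 ≤ m) (d : ℕ)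
          (D : Fin (d + 1) → Matrix (Fin m) (Fin m) ℂ),
        (∀ z ∈ Metric.closedBall (0 : ℂ) 1,
          ‖Matrix.toEuclideanCLM (𝕜 := ℂ) (∑ j : Fin (d + 1), (z ^ j.val) • D j)‖ ≤ 1) ∧
        ∃ B : PiLp 2 (fun _ : Fin m => lp (fun _ : ℕ => ℂ) 2) →L[ℂ]
            PiLp 2 (fun _ : Fin m => lp (fun _ : ℕ => ℂ) 2),
          (∀ (v : PiLp 2 (fun _ : Fin m => lp (fun _ : ℕ => ℂ) 2)) (r : Fin m),
            B v r = ∑ s : Fin m, ∑ j : Fin (d + 1), D j r s • (T ^ j.val) (v s)) ∧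
          c < ‖B‖) := by
  choose m hm W hW using fun n : ℕ => exists_isNilpotentSpinFamily (n + 1)
  have hne : ∀ n, Nonempty (Fin (n + 1) × Fin (m n)) := fun n => ⟨(0, ⟨0, hm n⟩)⟩
  obtain ⟨Φ⟩ := exists_linearIsometryEquiv_lp_nat fun n => Fin (n + 1) × Fin (m n)
  have hS : ∀ p : Polynomial ℂ,
      0 ≤ 35 * ⨆ z : Metric.closedBall (0 : ℂ) 1, ‖p.eval (z : ℂ)‖ := fun p =>
    mul_nonneg (by norm_num) (Real.iSup_nonneg fun _ => norm_nonneg _)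
  obtain ⟨T, hT, hTA⟩ := exists_directSum_operator (fun n => truncatedFoguelHankel n (W n)) hS
    fun n p => norm_aeval_truncatedFoguelHankel_le (hW n) p
  obtain ⟨T', hΦ⟩ : ∃ T' : lp (fun _ : ℕ => ℂ) 2 →L[ℂ] lp (fun _ : ℕ => ℂ) 2,
      ∀ x, T' (Φ x) = Φ (T x) :=
    ⟨(Φ.toContinuousLinearEquiv.toContinuousLinearMap.comp T).comp
      Φ.symm.toContinuousLinearEquiv.toContinuousLinearMap, fun x => by simp⟩
  refine ⟨T', ⟨35, by norm_num, fun p => ?_⟩, fun c _ => ?_⟩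
  · refine ContinuousLinearMap.opNorm_le_bound _ (hS p) fun y => ?_
    obtain ⟨x, rfl⟩ := Φ.surjective y
    have := aeval_apply_of_intertwining (L := Φ.toContinuousLinearEquiv.toContinuousLinearMap)
      hΦ p x
    refine (congrArg norm this).trans_le ?_
    refine (Φ.norm_map _).trans_le ?_
    rw [Φ.norm_map]
    exact (Polynomial.aeval T p).le_of_opNorm_le (hT p) x
  · obtain ⟨n, hn⟩ := exists_lt_sqrt_sum_one_div c
    refine ⟨m n, hm n, n + 1, testMatrix n (W n), fun z hz =>
      norm_sum_smul_testMatrix_le (hW n) (mem_closedBall_zero_iff.1 hz),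
      blockOperator _ _, blockOperator_apply _ _, ?_⟩
    refine hn.trans_le (exists_le_norm_blockOperator (hm n) (hW n) (Φ.toLinearIsometry.comp
      (lpSingleIsometry (fun n => EuclideanSpace ℂ (Fin (n + 1) × Fin (m n))) n)) fun x => ?_)
    exact (hΦ _).trans (congrArg Φ (hTA n x))
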